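/- (Opposite sign lemma.) Let γ₁, γ₂ be affine isometries of Minkowski space ℝ³, each hyperbolic or parabolic, such that the sign of γ₁ is strictly positive and the sign of γ₂ is strictly negative (or vice versa). Then the group generated by γ₁ and γ₂ does not act properly discontinuously on ℝ³. -/

import Mathlib

open Matrix

noncomputable section

/-- Minkowski space: ℝ³. -/
abbrev V3 : Type := Fin 3 → ℝ

/-- The Lorentzian inner product `x·y = x₁y₁ + x₂y₂ − x₃y₃`. -/
def mdot (x y : V3) : ℝ := x 0 * y 0 + x 1 * y 1 - x 2 * y 2

/-- The Lorentzian cross product: the unique bilinear map with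
`mdot u (lcross v w) = det [u v w]` (columns `u`, `v`, `w`). -/
def lcross (v w : V3) : V3 :=
  ![v 1 * w 2 - v 2 * w 1, v 2 * w 0 - v 0 * w 2, -(v 0 * w 1 - v 1 * w 0)]

/-- For a spacelike vector `v`, the future-pointing null vector `v⁺` of Euclidean
length 1 which is Lorentz-orthogonal to `v`, where `v⁻, v⁺` are ordered so that
`det[v⁻ v⁺ v] > 0`. -/
def nullPlus (v : V3) : V3 :=
  (1 / (Real.sqrt 2 * (v 0 ^ 2 + v 1 ^ 2))) •
    ![v 0 * v 2 + v 1 * Real.sqrt (mdot v v),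
      v 1 * v 2 - v 0 * Real.sqrt (mdot v v),
      v 0 ^ 2 + v 1 ^ 2]

/-- For a spacelike vector `v`, the future-pointing null vector `v⁻` of Euclidean
length 1 which is Lorentz-orthogonal to `v`, where `v⁻, v⁺` are ordered so that
`det[v⁻ v⁺ v] > 0`. -/
def nullMinus (v : V3) : V3 :=
  (1 / (Real.sqrt 2 * (v 0 ^ 2 + v 1 ^ 2))) •
    ![v 0 * v 2 - v 1 * Real.sqrt (mdot v v),
      v 1 * v 2 + v 0 * Real.sqrt (mdot v v),
      v 0 ^ 2 + v 1 ^ 2]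

/-- `P(x)`: for a future-pointing null vector `x`, the set of spacelike vectors `w`
with `w·x = 0` such that `(w/√(w·w))⁺` is a positive scalar multiple of `x`. -/
def wingSet (x : V3) : Set V3 :=
  {w | 0 < mdot w w ∧ mdot w x = 0 ∧
    ∃ t : ℝ, 0 < t ∧ nullPlus ((Real.sqrt (mdot w w))⁻¹ • w) = t • x}

/-- The crooked plane `C(v,p)`: union of the stem `p + {x | x·v = 0, x·x ≤ 0}`
and the wings `p + P(v⁺)` and `p + P(v⁻)`. -/
def crookedPlane (v p : V3) : Set V3 :=
  {q | mdot (q - p) v = 0 ∧ mdot (q - p) (q - p) ≤ 0} ∪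
  {q | q - p ∈ wingSet (nullPlus v)} ∪
  {q | q - p ∈ wingSet (nullMinus v)}

/-- The crooked half-space `H(v,p)`. -/
def crookedHalf (v p : V3) : Set V3 :=
  {q | (0 ≤ mdot (q - p) v → mdot (q - p) (nullPlus v) ≤ 0) ∧
       (mdot (q - p) v ≤ 0 → 0 ≤ mdot (q - p) (nullMinus v))}

/-- Spacelike vectors `u`, `v` are consistently oriented. -/
def consistentlyOriented (u v : V3) : Prop :=
  mdot u v < 0 ∧ mdot u (nullPlus v) ≤ 0 ∧ mdot u (nullMinus v) ≤ 0 ∧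
  mdot v (nullPlus u) ≤ 0 ∧ mdot v (nullMinus u) ≤ 0

/-- `g` is a linear isometry of the Lorentzian inner product. -/
def isLorentz (g : Matrix (Fin 3) (Fin 3) ℝ) : Prop :=
  ∀ x y : V3, mdot (g.mulVec x) (g.mulVec y) = mdot x y

/-- Membership in `SO(2,1)⁰`, the identity component of the group of linear
isometries of `mdot`: Lorentzian, determinant one, and orthochronous. -/
def inSO21p (g : Matrix (Fin 3) (Fin 3) ℝ) : Prop :=
  isLorentz g ∧ g.det = 1 ∧ 0 < g.mulVec ![0, 0, 1] 2

/-- `g` is hyperbolic: it has three distinct real eigenvalues. -/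
def isHyperbolic (g : Matrix (Fin 3) (Fin 3) ℝ) : Prop :=
  ∃ a b c : ℝ, a ≠ b ∧ a ≠ c ∧ b ≠ c ∧
    g.charpoly = (Polynomial.X - Polynomial.C a) * (Polynomial.X - Polynomial.C b) *
      (Polynomial.X - Polynomial.C c)

/-- `g ≠ I` is parabolic: `1` is its only eigenvalue. -/
def isParabolic (g : Matrix (Fin 3) (Fin 3) ℝ) : Prop :=
  g ≠ 1 ∧ g.charpoly = (Polynomial.X - Polynomial.C 1) ^ 3

/-- `v` is a positive fixed vector of `g`: `gv = v`, `v ≠ 0`, and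
`det[v x gx] > 0` for some null or timelike `x` which is not an eigenvector. -/
def positiveFixed (g : Matrix (Fin 3) (Fin 3) ℝ) (v : V3) : Prop :=
  v ≠ 0 ∧ g.mulVec v = v ∧
  ∃ x : V3, mdot x x ≤ 0 ∧ (∀ t : ℝ, g.mulVec x ≠ t • x) ∧
    0 < mdot v (lcross x (g.mulVec x))

/-- A subgroup of homeomorphisms (here: permutations) of ℝ³ acts properly
discontinuously: for every compact `K`, only finitely many elements move `K`
to meet `K`. -/
def properlyDisc (Γ : Subgroup (Equiv.Perm V3)) : Prop :=
  ∀ K : Set V3, IsCompact K →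
    {f : Equiv.Perm V3 | f ∈ Γ ∧ ((f : V3 → V3) '' K ∩ K).Nonempty}.Finite

/-- The action of `Γ` on ℝ³ is free: no nonidentity element has a fixed point. -/
def freeAction (Γ : Subgroup (Equiv.Perm V3)) : Prop :=
  ∀ f ∈ Γ, f ≠ 1 → ∀ x : V3, f x ≠ x

section Algebra

lemma mdot_comm (x y : V3) : mdot x y = mdot y x := by
  simp only [mdot]; ring

lemma mdot_add_right (a x y : V3) : mdot a (x + y) = mdot a x + mdot a y := by
  simp only [mdot, Pi.add_apply]; ring

lemma mdot_sub_right (a x y : V3) : mdot a (x - y) = mdot a x - mdot a y := by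
  simp only [mdot, Pi.sub_apply]; ring

lemma mdot_smul_right (a x : V3) (t : ℝ) : mdot a (t • x) = t * mdot a x := by
  simp only [mdot, Pi.smul_apply, smul_eq_mul]; ring

lemma mdot_neg_right (a x : V3) : mdot a (-x) = -mdot a x := by
  simp only [mdot, Pi.neg_apply]; ring

lemma mdot_zero_right (a : V3) : mdot a 0 = 0 := by
  simp [mdot]

lemma mdot_add_left (a x y : V3) : mdot (x + y) a = mdot x a + mdot y a := by
  simp only [mdot, Pi.add_apply]; ring

lemma mdot_sub_left (a x y : V3) : mdot (x - y) a = mdot x a - mdot y a := by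
  simp only [mdot, Pi.sub_apply]; ring

lemma mdot_smul_left (a x : V3) (t : ℝ) : mdot (t • x) a = t * mdot x a := by
  simp only [mdot, Pi.smul_apply, smul_eq_mul]; ring

lemma mdot_neg_left (a x : V3) : mdot (-x) a = -mdot x a := by
  simp only [mdot, Pi.neg_apply]; ring

lemma mdot_zero_left (a : V3) : mdot 0 a = 0 := by
  simp [mdot]

lemma V3.ext3 {a b : V3} (h0 : a 0 = b 0) (h1 : a 1 = b 1) (h2 : a 2 = b 2) : a = b := by
  ext i; fin_cases i <;> assumption

lemma lcross_zero (a b : V3) : lcross a b 0 = a 1 * b 2 - a 2 * b 1 := rfl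
lemma lcross_one (a b : V3) : lcross a b 1 = a 2 * b 0 - a 0 * b 2 := rfl
lemma lcross_two (a b : V3) : lcross a b 2 = -(a 0 * b 1 - a 1 * b 0) := rfl

lemma eq_of_forall_mdot {a b : V3} (h : ∀ y, mdot a y = mdot b y) : a = b := by
  have h0 := h ![1, 0, 0]
  have h1 := h ![0, 1, 0]
  have h2 := h ![0, 0, 1]
  simp [mdot] at h0 h1 h2
  exact V3.ext3 h0 h1 h2

lemma lcross_smul_left (t : ℝ) (a b : V3) : lcross (t • a) b = t • lcross a b := by
  apply V3.ext3 <;> simp only [lcross_zero, lcross_one, lcross_two, Pi.smul_apply, smul_eq_mul] <;>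
    ring

lemma lcross_smul_right (t : ℝ) (a b : V3) : lcross a (t • b) = t • lcross a b := by
  apply V3.ext3 <;> simp only [lcross_zero, lcross_one, lcross_two, Pi.smul_apply, smul_eq_mul] <;>
    ring

lemma lcross_neg_left (a b : V3) : lcross (-a) b = -lcross a b := by
  apply V3.ext3 <;> simp only [lcross_zero, lcross_one, lcross_two, Pi.neg_apply] <;> ring

lemma lcross_anticomm (a b : V3) : lcross a b = -lcross b a := by
  apply V3.ext3 <;> simp only [lcross_zero, lcross_one, lcross_two, Pi.neg_apply] <;> ring

lemma lcross_add_right (a b c : V3) : lcross a (b + c) = lcross a b + lcross a c := by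
  apply V3.ext3 <;> simp only [lcross_zero, lcross_one, lcross_two, Pi.add_apply] <;> ring

lemma lcross_sub_right (a b c : V3) : lcross a (b - c) = lcross a b - lcross a c := by
  apply V3.ext3 <;> simp only [lcross_zero, lcross_one, lcross_two, Pi.sub_apply] <;> ring

lemma lcross_self (a : V3) : lcross a a = 0 := by
  apply V3.ext3 <;> simp only [lcross_zero, lcross_one, lcross_two, Pi.zero_apply] <;> ring

lemma mdot_lcross_self_left (a b : V3) : mdot a (lcross a b) = 0 := by
  simp only [mdot, lcross_zero, lcross_one, lcross_two]; ring

lemma mdot_lcross_self_right (a b : V3) : mdot b (lcross a b) = 0 := by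
  simp only [mdot, lcross_zero, lcross_one, lcross_two]; ring

lemma mdot_lcross_cycle (a b c : V3) : mdot a (lcross b c) = mdot (lcross a b) c := by
  simp only [mdot, lcross_zero, lcross_one, lcross_two]; ring

lemma lcross_lcross (a b c : V3) :
    lcross a (lcross b c) = mdot a b • c - mdot a c • b := by
  apply V3.ext3 <;> simp only [mdot, lcross_zero, lcross_one, lcross_two, Pi.smul_apply,
    Pi.sub_apply, smul_eq_mul] <;> ring

lemma mdot_lcross_lcross (a b c d : V3) :
    mdot (lcross a b) (lcross c d) = mdot a d * mdot b c - mdot a c * mdot b d := by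
  simp only [mdot, lcross_zero, lcross_one, lcross_two]; ring

lemma cramer_mdot (a b c x : V3) :
    mdot a (lcross b c) • x =
      mdot a x • lcross b c + mdot b x • lcross c a + mdot c x • lcross a b := by
  apply V3.ext3 <;> simp only [mdot, lcross_zero, lcross_one, lcross_two, Pi.smul_apply,
    Pi.add_apply, smul_eq_mul] <;> ring

lemma exists_smul_of_lcross_eq_zero {a b : V3} (h : lcross a b = 0) (hb : b ≠ 0) :
    ∃ t : ℝ, a = t • b := by
  have h0 : a 1 * b 2 - a 2 * b 1 = 0 := congrFun h 0
  have h1 : a 2 * b 0 - a 0 * b 2 = 0 := congrFun h 1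
  have h2 : -(a 0 * b 1 - a 1 * b 0) = 0 := congrFun h 2
  have hb' : b 0 ≠ 0 ∨ b 1 ≠ 0 ∨ b 2 ≠ 0 := by
    by_contra! hc
    exact hb (V3.ext3 hc.1 hc.2.1 hc.2.2)
  rcases hb' with hb' | hb' | hb'
  · refine ⟨a 0 / b 0, V3.ext3 ?_ ?_ ?_⟩ <;> simp only [Pi.smul_apply, smul_eq_mul] <;>
      field_simp <;> linarith
  · refine ⟨a 1 / b 1, V3.ext3 ?_ ?_ ?_⟩ <;> simp only [Pi.smul_apply, smul_eq_mul] <;>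
      field_simp <;> linarith
  · refine ⟨a 2 / b 2, V3.ext3 ?_ ?_ ?_⟩ <;> simp only [Pi.smul_apply, smul_eq_mul] <;>
      field_simp <;> linarith

lemma third_ne_zero {x : V3} (hx : mdot x x ≤ 0) (h0 : x ≠ 0) : x 2 ≠ 0 := by
  intro h2
  simp only [mdot, h2] at hx
  exact h0 (V3.ext3 (by simp only [Pi.zero_apply]; nlinarith [sq_nonneg (x 0), sq_nonneg (x 1)])
    (by simp only [Pi.zero_apply]; nlinarith [sq_nonneg (x 0), sq_nonneg (x 1)]) h2)

lemma null_parallel {a b : V3} (ha : mdot a a = 0) (hb : mdot b b = 0) (hab : mdot a b = 0)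
    (hb0 : b ≠ 0) : ∃ t : ℝ, a = t • b := by
  have h2 := third_ne_zero hb.le hb0
  have hc : mdot (a 2 • b - b 2 • a) (a 2 • b - b 2 • a) = 0 := by
    simp only [mdot_sub_left, mdot_sub_right, mdot_smul_left, mdot_smul_right, ha, hb, hab,
      mdot_comm b a]; ring
  have hc0 : a 2 • b - b 2 • a = 0 := by
    by_contra hne
    refine third_ne_zero hc.le hne ?_
    simp only [Pi.sub_apply, Pi.smul_apply, smul_eq_mul]; ring
  refine ⟨a 2 / b 2, ?_⟩
  have := sub_eq_zero.1 hc0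
  rw [div_eq_inv_mul, mul_smul, this, smul_smul, inv_mul_cancel₀ h2, one_smul]

/-- Reversed Cauchy–Schwarz inequality for causal vectors with the same time orientation. -/
lemma mdot_le_of_causal {x y : V3} (hx : mdot x x ≤ 0) (hxy : mdot y y = mdot x x)
    (h : 0 ≤ x 2 * y 2) : mdot x y ≤ mdot x x := by
  obtain ⟨q, hq⟩ : ∃ q, q = mdot x x := ⟨_, rfl⟩
  rw [← hq] at hx hxy ⊢
  simp only [mdot] at hq hxy ⊢
  have hx2 : x 0 ^ 2 + x 1 ^ 2 = x 2 ^ 2 + q := by linarith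
  have hy2 : y 0 ^ 2 + y 1 ^ 2 = y 2 ^ 2 + q := by linarith
  have hb : -q ≤ x 2 * y 2 := by
    refine le_of_sq_le_sq ?_ h
    have h1 : -q ≤ x 2 ^ 2 := by nlinarith [sq_nonneg (x 0), sq_nonneg (x 1)]
    have h2 : -q ≤ y 2 ^ 2 := by nlinarith [sq_nonneg (y 0), sq_nonneg (y 1)]
    nlinarith [mul_le_mul h1 h2 (by linarith) (sq_nonneg (x 2))]
  have hcs : (x 0 * y 0 + x 1 * y 1) ^ 2 ≤ (x 2 * y 2 + q) ^ 2 := by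
    have h1 : (x 0 * y 0 + x 1 * y 1) ^ 2 ≤ (x 2 ^ 2 + q) * (y 2 ^ 2 + q) := by
      rw [← hx2, ← hy2]; nlinarith [sq_nonneg (x 0 * y 1 - x 1 * y 0)]
    nlinarith [mul_nonneg (neg_nonneg.2 hx) (sq_nonneg (x 2 - y 2))]
  have := abs_le_of_sq_le_sq' hcs (by linarith)
  linarith [this.2]

end Algebra

section Dynamics

lemma perm_apply_inv (σ : Equiv.Perm V3) (x : V3) : σ (σ⁻¹ x) = x := σ.apply_symm_apply x

lemma perm_inv_apply (σ : Equiv.Perm V3) (x : V3) : σ⁻¹ (σ x) = x := σ.symm_apply_apply x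

/-- If infinitely many elements of `Γ` move a point of a compact set into that set, then the
action is not properly discontinuous. -/
lemma not_properlyDisc_of_injective {Γ : Subgroup (Equiv.Perm V3)} {K : Set V3} (hK : IsCompact K)
    {h : ℕ → Equiv.Perm V3} (hinj : Function.Injective h) (hΓ : ∀ n, h n ∈ Γ)
    {x : ℕ → V3} (hx : ∀ n, x n ∈ K) (hhx : ∀ n, h n (x n) ∈ K) : ¬ properlyDisc Γ := by
  intro hpd
  have hmem : ∀ n, h n ∈ {f : Equiv.Perm V3 | f ∈ Γ ∧ ((f : V3 → V3) '' K ∩ K).Nonempty} :=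
    fun n => ⟨hΓ n, h n (x n), ⟨x n, hx n, rfl⟩, hhx n⟩
  exact Set.infinite_of_injective_forall_mem hinj hmem (hpd K hK)

/-- The points where three independent linear forms are bounded lie in a compact set. -/
lemma exists_compact_of_bounded {a b c : V3} (hdet : mdot a (lcross b c) ≠ 0) (R : ℝ) :
    ∃ K : Set V3, IsCompact K ∧
      ∀ x, |mdot a x| ≤ R → |mdot b x| ≤ R → |mdot c x| ≤ R → x ∈ K := by
  let φ : ℝ × ℝ × ℝ → V3 := fun p => (mdot a (lcross b c))⁻¹ •
    (p.1 • lcross b c + p.2.1 • lcross c a + p.2.2 • lcross a b)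
  have hφ : Continuous φ := by fun_prop
  refine ⟨φ '' (Set.Icc (-R) R ×ˢ (Set.Icc (-R) R ×ˢ Set.Icc (-R) R)),
    (isCompact_Icc.prod (isCompact_Icc.prod isCompact_Icc)).image hφ, ?_⟩
  intro x ha hb hc
  refine ⟨(mdot a x, mdot b x, mdot c x), ⟨abs_le.1 ha, abs_le.1 hb, abs_le.1 hc⟩, ?_⟩
  simp only [φ]
  rw [← cramer_mdot, smul_smul, inv_mul_cancel₀ hdet, one_smul]

/-- Dynamical data of a hyperbolic affine isometry `γ`: `F` spans its neutral direction, `e` and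
`f` are the expanding and contracting eigenvectors of its linear part, with expansion factor `l`,
and `s` is its Margulis invariant with respect to `F`. -/
structure HypData (γ : Equiv.Perm V3) (F e f : V3) (l s : ℝ) : Prop where
  one_lt : 1 < l
  neutral : ∀ x, mdot F (γ x) = mdot F x + s
  expand : ∀ x y, mdot e (γ x - γ y) = l⁻¹ * mdot e (x - y)
  contract : ∀ x y, mdot f (γ x - γ y) = l * mdot f (x - y)
  cross_expand : ∃ μ : ℝ, 0 < μ ∧ lcross F e = μ • e
  cross_contract : ∃ μ : ℝ, 0 < μ ∧ lcross F f = (-μ) • f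
  mdot_ne : mdot e f ≠ 0

namespace HypData

variable {γ δ : Equiv.Perm V3} {F e f F' e' f' : V3} {l s l' s' : ℝ}

lemma inv (h : HypData γ F e f l s) : HypData γ⁻¹ (-F) f e l s where
  one_lt := h.one_lt
  neutral x := by
    have := h.neutral (γ⁻¹ x)
    rw [perm_apply_inv] at this
    rw [mdot_neg_left, mdot_neg_left, this]; ring
  expand x y := by
    have := h.contract (γ⁻¹ x) (γ⁻¹ y)
    rw [perm_apply_inv, perm_apply_inv] at this
    rw [this, inv_mul_cancel_left₀ (by linarith [h.one_lt])]
  contract x y := by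
    have := h.expand (γ⁻¹ x) (γ⁻¹ y)
    rw [perm_apply_inv, perm_apply_inv] at this
    rw [this, mul_inv_cancel_left₀ (by linarith [h.one_lt])]
  cross_expand := by
    obtain ⟨μ, h0, h1⟩ := h.cross_contract
    exact ⟨μ, h0, by rw [lcross_neg_left, h1, neg_smul, neg_neg]⟩
  cross_contract := by
    obtain ⟨μ, h0, h1⟩ := h.cross_expand
    exact ⟨μ, h0, by rw [lcross_neg_left, h1, neg_smul]⟩
  mdot_ne := by rw [mdot_comm]; exact h.mdot_ne

lemma null_contract (h : HypData γ F e f l s) : mdot f f = 0 := by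
  obtain ⟨μ, h0, h1⟩ := h.cross_contract
  have := mdot_lcross_self_right F f
  rw [h1, mdot_smul_right] at this
  exact (mul_eq_zero.1 this).resolve_left (by linarith)

lemma null_expand (h : HypData γ F e f l s) : mdot e e = 0 := h.inv.null_contract

lemma contract_ne_zero (h : HypData γ F e f l s) : f ≠ 0 := by
  rintro rfl
  exact h.mdot_ne (mdot_zero_right e)

lemma neutral_pow (h : HypData γ F e f l s) (n : ℕ) (x : V3) :
    mdot F ((γ ^ n) x) = mdot F x + n * s := by
  induction n with
  | zero => simp
  | succ n ih =>
    rw [pow_succ', Equiv.Perm.mul_apply, h.neutral, ih]; push_cast; ring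

lemma contract_pow (h : HypData γ F e f l s) (n : ℕ) (x y : V3) :
    mdot f ((γ ^ n) x - (γ ^ n) y) = l ^ n * mdot f (x - y) := by
  induction n with
  | zero => simp
  | succ n ih =>
    rw [pow_succ', Equiv.Perm.mul_apply, Equiv.Perm.mul_apply, h.contract, ih]; ring

/-- The level set of `f` preserved by `γ`. -/
lemma exists_contract_fixed (h : HypData γ F e f l s) :
    ∃ k : ℝ, ∀ (n : ℕ) (x : V3), mdot f x = k → mdot f ((γ ^ n) x) = k := by
  have hl : 1 - l ≠ 0 := by linarith [h.one_lt]
  refine ⟨mdot f (γ 0) / (1 - l), fun n x hx => ?_⟩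
  induction n with
  | zero => simpa using hx
  | succ n ih =>
    have := h.contract ((γ ^ n) x) 0
    rw [sub_zero, ih, mdot_sub_right] at this
    rw [pow_succ', Equiv.Perm.mul_apply]
    have h2 : mdot f (γ ((γ ^ n) x)) = l * (mdot f (γ 0) / (1 - l)) + mdot f (γ 0) := by linarith
    rw [h2]; field_simp; ring

/-- The `e`-coordinate is bounded along orbits that start at a distance linear in the time. -/
lemma expand_bounded (h : HypData γ F e f l s) (C : ℝ) :
    ∃ R : ℝ, ∀ (n : ℕ) (x : V3), |mdot e x| ≤ C * (1 + n) → |mdot e ((γ ^ n) x)| ≤ R := by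
  have hl : 0 < l - 1 := by linarith [h.one_lt]
  have hl0 : 0 < l := by linarith
  obtain ⟨k, hk⟩ : ∃ k, k = mdot e (γ 0) / (1 - l⁻¹) := ⟨_, rfl⟩
  have hl1 : 1 - l⁻¹ ≠ 0 := by
    have := inv_lt_one_of_one_lt₀ h.one_lt
    linarith
  have hk' : mdot e (γ 0) = k - l⁻¹ * k := by rw [hk]; field_simp
  have key : ∀ (n : ℕ) (x : V3), l ^ n * (mdot e ((γ ^ n) x) - k) = mdot e x - k := by
    intro n x
    induction n with
    | zero => simp
    | succ n ih =>
      have := h.expand ((γ ^ n) x) 0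
      rw [sub_zero, mdot_sub_right, hk'] at this
      rw [← ih, pow_succ' γ, Equiv.Perm.mul_apply, pow_succ]
      have h2 : mdot e (γ ((γ ^ n) x)) - k = l⁻¹ * (mdot e ((γ ^ n) x) - k) := by linarith
      rw [h2]; field_simp
  refine ⟨(|C| + |k|) * (1 + (l - 1)⁻¹) + |k|, fun n x hx => ?_⟩
  have hb : 1 + n * (l - 1) ≤ l ^ n := by
    have := one_add_mul_le_pow (a := l - 1) (by linarith) n
    simpa using this
  have hn : (0 : ℝ) ≤ n := n.cast_nonneg
  have hpos : 0 < l ^ n := by positivity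
  have h1 : (1 + n : ℝ) ≤ l ^ n * (1 + (l - 1)⁻¹) := by
    have h2 : (1 + n * (l - 1)) * (1 + (l - 1)⁻¹) ≤ l ^ n * (1 + (l - 1)⁻¹) := by gcongr
    have h3 : (1 + n * (l - 1)) * (1 + (l - 1)⁻¹) = 1 + n + (l - 1)⁻¹ + n * (l - 1) := by
      field_simp; ring
    have : 0 < (l - 1)⁻¹ := by positivity
    nlinarith [mul_nonneg hn hl.le]
  have h2 : |mdot e x - k| ≤ (|C| + |k|) * (1 + n) := by
    calc |mdot e x - k| ≤ |mdot e x| + |k| := abs_sub _ _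
      _ ≤ |C| * (1 + n) + |k| * (1 + n) := by
        have : C * (1 + n) ≤ |C| * (1 + n) := by gcongr; exact le_abs_self C
        nlinarith [abs_nonneg k, mul_nonneg (abs_nonneg k) hn]
      _ = _ := by ring
  have h3 : l ^ n * |mdot e ((γ ^ n) x) - k| ≤ l ^ n * ((|C| + |k|) * (1 + (l - 1)⁻¹)) := by
    calc l ^ n * |mdot e ((γ ^ n) x) - k| = |mdot e x - k| := by
          rw [← key n x, abs_mul, abs_of_pos hpos]
      _ ≤ (|C| + |k|) * (1 + n) := h2
      _ ≤ (|C| + |k|) * (l ^ n * (1 + (l - 1)⁻¹)) := by gcongr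
      _ = _ := by ring
  have h4 := le_of_mul_le_mul_left h3 hpos
  have h5 := abs_add_le (mdot e ((γ ^ n) x) - k) k
  rw [sub_add_cancel] at h5
  linarith

lemma det_ne_zero (h : HypData γ F e f l s) : mdot F (lcross e f) ≠ 0 := by
  obtain ⟨μ, h0, h1⟩ := h.cross_expand
  rw [mdot_lcross_cycle, h1, mdot_smul_left]
  exact mul_ne_zero h0.ne' h.mdot_ne

lemma mdot_neutral_contract (h : HypData γ F e f l s) : mdot F f = 0 := by
  obtain ⟨μ, h0, h1⟩ := h.cross_contract
  have := mdot_lcross_self_left F f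
  rw [h1, mdot_smul_right] at this
  exact (mul_eq_zero.1 this).resolve_left (by linarith)

lemma mdot_neutral_pos (h : HypData γ F e f l s) : 0 < mdot F F := by
  obtain ⟨μ, h0, h1⟩ := h.cross_contract
  have h2 := lcross_lcross F F f
  rw [h.mdot_neutral_contract, zero_smul, sub_zero, h1, lcross_smul_right, h1, smul_smul] at h2
  rw [← smul_left_injective ℝ h.contract_ne_zero h2]
  nlinarith

lemma expand_pow (h : HypData γ F e f l s) (n : ℕ) (x y : V3) :
    mdot e ((γ ^ n) x - (γ ^ n) y) = l⁻¹ ^ n * mdot e (x - y) := by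
  induction n with
  | zero => simp
  | succ n ih =>
    rw [pow_succ', Equiv.Perm.mul_apply, Equiv.Perm.mul_apply, h.expand, ih]; ring

lemma contract_vec_pow (h : HypData γ F e f l s) (n : ℕ) :
    (γ ^ n) f - (γ ^ n) 0 = (l⁻¹ ^ n) • f := by
  have hF : mdot F ((γ ^ n) f - (γ ^ n) 0) = mdot F ((l⁻¹ ^ n) • f) := by
    rw [mdot_sub_right, h.neutral_pow, h.neutral_pow, mdot_zero_right, mdot_smul_right,
      h.mdot_neutral_contract]; ring
  have he : mdot e ((γ ^ n) f - (γ ^ n) 0) = mdot e ((l⁻¹ ^ n) • f) := by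
    rw [h.expand_pow, sub_zero, mdot_smul_right]
  have hf : mdot f ((γ ^ n) f - (γ ^ n) 0) = mdot f ((l⁻¹ ^ n) • f) := by
    rw [h.contract_pow, sub_zero, mdot_smul_right, h.null_contract]; ring
  have hc := cramer_mdot F e f ((γ ^ n) f - (γ ^ n) 0)
  rw [hF, he, hf, ← cramer_mdot] at hc
  exact smul_right_injective _ h.det_ne_zero hc

lemma not_properlyDisc_of_transverse {Γ : Subgroup (Equiv.Perm V3)} (hγΓ : γ ∈ Γ) (hδΓ : δ ∈ Γ)
    (hγ : HypData γ F e f l s) (hδ : HypData δ F' e' f' l' s') (hs : s * s' < 0)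
    (htr : mdot f f' ≠ 0) : ¬ properlyDisc Γ := by
  obtain ⟨d, hd⟩ : ∃ d, d = mdot f f' := ⟨_, rfl⟩
  rw [← hd] at htr
  obtain ⟨μ, hμ, hμf⟩ := hγ.cross_contract
  obtain ⟨μ', hμ', hμf'⟩ := hδ.cross_contract
  have hs0 : s ≠ 0 := by rintro rfl; simp at hs
  have hs0' : s' ≠ 0 := by rintro rfl; simp at hs
  obtain ⟨k, hk⟩ := hγ.exists_contract_fixed
  obtain ⟨k', hk'⟩ := hδ.exists_contract_fixed
  obtain ⟨w, hw⟩ : ∃ w, w = lcross f f' := ⟨_, rfl⟩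
  have hFw : mdot F w = -(μ * d) := by
    rw [hw, mdot_lcross_cycle, hμf, mdot_smul_left, hd]; ring
  have hFw' : mdot F' w = μ' * d := by
    rw [hw, lcross_anticomm, mdot_neg_right, mdot_lcross_cycle, hμf', mdot_smul_left, mdot_comm,
      hd]; ring
  have hfw : mdot f w = 0 := by rw [hw]; exact mdot_lcross_self_left _ _
  have hfw' : mdot f' w = 0 := by rw [hw]; exact mdot_lcross_self_right _ _
  obtain ⟨q, hq⟩ : ∃ q, q = (k' / d) • f + (k / d) • f' := ⟨_, rfl⟩
  have hfq : mdot f q = k := by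
    rw [hq, mdot_add_right, mdot_smul_right, mdot_smul_right, hγ.null_contract, ← hd]
    field_simp; ring
  have hfq' : mdot f' q = k' := by
    rw [hq, mdot_add_right, mdot_smul_right, mdot_smul_right, hδ.null_contract, mdot_comm, ← hd]
    field_simp; ring
  obtain ⟨t, ht⟩ : ∃ t, t = s / (μ * d) := ⟨_, rfl⟩
  obtain ⟨c, hc⟩ : ∃ c, c = -(s * μ') / (μ * s') := ⟨_, rfl⟩
  have hc0 : 0 < c := by
    have : c = -(s * s') * μ' / (μ * s' ^ 2) := by rw [hc]; field_simp
    rw [this]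
    have : 0 < -(s * s') := by linarith
    positivity
  let y : ℕ → V3 := fun n => q + (n * t) • w
  let m : ℕ → ℕ := fun n => ⌊c * n⌋₊
  have hfy : ∀ n, mdot f (y n) = k := by
    intro n; simp only [y]; rw [mdot_add_right, mdot_smul_right, hfw, hfq]; ring
  have hfy' : ∀ n, mdot f' (y n) = k' := by
    intro n; simp only [y]; rw [mdot_add_right, mdot_smul_right, hfw', hfq']; ring
  have hm1 : ∀ n : ℕ, (m n : ℝ) ≤ c * n := fun n => Nat.floor_le (by positivity)
  have hm2 : ∀ n : ℕ, c * n < m n + 1 := fun n => Nat.lt_floor_add_one _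
  -- growth of the expanding coordinates of `y`
  have hgrow : ∀ a : V3, ∀ n : ℕ, |mdot a (y n)| ≤ |mdot a q| + |t * mdot a w| * n := by
    intro a n
    simp only [y]
    rw [mdot_add_right, mdot_smul_right]
    refine (abs_add_le _ _).trans ?_
    have : (n : ℝ) * t * mdot a w = (t * mdot a w) * n := by ring
    rw [this, abs_mul, abs_of_nonneg (n.cast_nonneg : (0 : ℝ) ≤ n)]
  obtain ⟨R1, hR1⟩ := hγ.expand_bounded (|mdot e q| + |t * mdot e w|)
  obtain ⟨R2, hR2⟩ := hδ.expand_bounded (|mdot e' q| + |t * mdot e' w| * c⁻¹)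
  have hx1 : ∀ n, |mdot e ((γ ^ n) (y n))| ≤ R1 := by
    intro n
    apply hR1
    refine (hgrow e n).trans ?_
    have hn : (0 : ℝ) ≤ n := n.cast_nonneg
    nlinarith [abs_nonneg (mdot e q), abs_nonneg (t * mdot e w),
      mul_nonneg (abs_nonneg (mdot e q)) hn]
  have hx2 : ∀ n, |mdot e' ((δ ^ m n) (y n))| ≤ R2 := by
    intro n
    apply hR2
    refine (hgrow e' n).trans ?_
    have hn : (0 : ℝ) ≤ m n := (m n).cast_nonneg
    have h1 : (n : ℝ) ≤ c⁻¹ * (1 + m n) := by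
      rw [inv_mul_eq_div, le_div_iff₀ hc0]; linarith [hm2 n]
    calc |mdot e' q| + |t * mdot e' w| * n
        ≤ |mdot e' q| * (1 + m n) + |t * mdot e' w| * (c⁻¹ * (1 + m n)) := by
          gcongr
          nlinarith [abs_nonneg (mdot e' q)]
      _ = _ := by ring
  have hF1 : ∀ n, mdot F ((γ ^ n) (y n)) = mdot F q := by
    intro n
    rw [hγ.neutral_pow]; simp only [y]
    rw [mdot_add_right, mdot_smul_right, hFw, ht]; field_simp; ring
  have hF2 : ∀ n, |mdot F' ((δ ^ m n) (y n))| ≤ |mdot F' q| + |s'| := by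
    intro n
    rw [hδ.neutral_pow]; simp only [y]
    rw [mdot_add_right, mdot_smul_right, hFw']
    have : mdot F' q + n * t * (μ' * d) + m n * s' = mdot F' q + s' * (m n - c * n) := by
      rw [ht, hc]; field_simp; ring
    rw [this]
    refine (abs_add_le _ _).trans ?_
    rw [abs_mul]
    have h1 : |(m n : ℝ) - c * n| ≤ 1 := by
      rw [abs_le]; constructor <;> linarith [hm1 n, hm2 n]
    nlinarith [abs_nonneg s']
  obtain ⟨K1, hK1, hK1'⟩ := exists_compact_of_bounded hγ.det_ne_zero (|mdot F q| + |R1| + |k|)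
  obtain ⟨K2, hK2, hK2'⟩ := exists_compact_of_bounded hδ.det_ne_zero
    (|mdot F' q| + |s'| + |R2| + |k'|)
  have hinj : Function.Injective fun n => δ ^ m n * (γ ^ n)⁻¹ := by
    have key : ∀ i j : ℕ, i < j → δ ^ m i * (γ ^ i)⁻¹ ≠ δ ^ m j * (γ ^ j)⁻¹ := by
      intro i j hij heq
      have hmij : m i ≤ m j := Nat.floor_mono (by gcongr)
      obtain ⟨b, rfl⟩ := Nat.exists_eq_add_of_lt hij
      obtain ⟨a, ha⟩ := Nat.exists_eq_add_of_le hmij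
      rw [ha] at heq
      have h1 : γ ^ (b + 1) = δ ^ a := by
        have h2 : (γ ^ (i + b + 1))⁻¹ = (γ ^ (b + 1))⁻¹ * (γ ^ i)⁻¹ := by
          rw [← _root_.mul_inv_rev, ← pow_add, add_assoc]
        rw [h2, pow_add, ← mul_assoc, mul_assoc (δ ^ m i)] at heq
        have h3 := mul_left_cancel (mul_right_cancel ((mul_one (δ ^ m i)).symm ▸ heq))
        exact (mul_inv_eq_one.1 h3.symm).symm
      have h2 := hδ.contract_pow a f 0
      rw [← h1, hγ.contract_vec_pow, sub_zero, mdot_smul_right, mdot_comm f' f, ← hd] at h2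
      have h3 := mul_right_cancel₀ htr h2
      have h4 : 1 ≤ l' ^ a := one_le_pow₀ hδ.one_lt.le
      have h5 : (l⁻¹) ^ (b + 1) < 1 :=
        pow_lt_one₀ (by have := hγ.one_lt; positivity) (inv_lt_one_of_one_lt₀ hγ.one_lt)
          (Nat.succ_ne_zero b)
      linarith
    intro i j hij
    rcases lt_trichotomy i j with h | h | h
    · exact absurd hij (key i j h)
    · exact h
    · exact absurd hij.symm (key j i h)
  refine not_properlyDisc_of_injective (hK1.union hK2) hinj
    (fun n => Γ.mul_mem (Γ.pow_mem hδΓ _) (Γ.inv_mem (Γ.pow_mem hγΓ _)))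
    (x := fun n => (γ ^ n) (y n)) (fun n => Or.inl (hK1' _ ?_ ?_ ?_))
    (fun n => Or.inr ?_)
  · rw [hF1]; linarith [abs_nonneg R1, abs_nonneg k]
  · linarith [hx1 n, le_abs_self R1, abs_nonneg (mdot F q), abs_nonneg k]
  · rw [hk n _ (hfy n)]; linarith [abs_nonneg R1, abs_nonneg (mdot F q)]
  · rw [Equiv.Perm.mul_apply, perm_inv_apply]
    apply hK2'
    · linarith [hF2 n, abs_nonneg R2, abs_nonneg k']
    · linarith [hx2 n, le_abs_self R2, abs_nonneg (mdot F' q), abs_nonneg k', abs_nonneg s']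
    · rw [hk' _ _ (hfy' n)]; linarith [abs_nonneg R2, abs_nonneg (mdot F' q), abs_nonneg s']

/-- Two hyperbolic elements with opposite signs generate a group not acting properly
discontinuously. -/
lemma not_properlyDisc {Γ : Subgroup (Equiv.Perm V3)} (hγΓ : γ ∈ Γ) (hδΓ : δ ∈ Γ)
    (hγ : HypData γ F e f l s) (hδ : HypData δ F' e' f' l' s') (hs : s * s' < 0) :
    ¬ properlyDisc Γ := by
  by_cases hf : mdot f f' = 0
  · refine not_properlyDisc_of_transverse (Γ.inv_mem hγΓ) hδΓ hγ.inv hδ hs fun he => ?_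
    obtain ⟨a, ha⟩ := null_parallel hγ.null_contract hδ.null_contract hf hδ.contract_ne_zero
    obtain ⟨b, hb⟩ := null_parallel hγ.null_expand hδ.null_contract he hδ.contract_ne_zero
    apply hγ.mdot_ne
    rw [ha, hb, mdot_smul_left, mdot_smul_right, hδ.null_contract]; ring
  · exact not_properlyDisc_of_transverse hγΓ hδΓ hγ hδ hs hf

end HypData

end Dynamics

section Lorentz

variable {g h : Matrix (Fin 3) (Fin 3) ℝ}

lemma mulVec_apply_fin_three (g : Matrix (Fin 3) (Fin 3) ℝ) (x : V3) (i : Fin 3) :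
    (g *ᵥ x) i = g i 0 * x 0 + g i 1 * x 1 + g i 2 * x 2 := by
  simp [Matrix.mulVec, dotProduct, Fin.sum_univ_three]

/-- The adjoint of `g` with respect to `mdot`. -/
def lorentzAdj (g : Matrix (Fin 3) (Fin 3) ℝ) : Matrix (Fin 3) (Fin 3) ℝ :=
  !![g 0 0, g 1 0, -g 2 0; g 0 1, g 1 1, -g 2 1; -g 0 2, -g 1 2, g 2 2]

/-- The vector `F` such that `g - g*` is the map `x ↦ F × x`, where `g*` is the adjoint of `g`. -/
def skewVec (g : Matrix (Fin 3) (Fin 3) ℝ) : V3 :=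
  ![-(g 1 2 + g 2 1), g 0 2 + g 2 0, g 1 0 - g 0 1]

lemma mdot_lorentzAdj_mulVec (g : Matrix (Fin 3) (Fin 3) ℝ) (x y : V3) :
    mdot (lorentzAdj g *ᵥ x) y = mdot x (g *ᵥ y) := by
  simp only [mdot, mulVec_apply_fin_three]
  simp [lorentzAdj]; ring

lemma lcross_skewVec (g : Matrix (Fin 3) (Fin 3) ℝ) (x : V3) :
    lcross (skewVec g) x = g *ᵥ x - lorentzAdj g *ᵥ x := by
  apply V3.ext3 <;>
    simp only [lcross_zero, lcross_one, lcross_two, Pi.sub_apply, mulVec_apply_fin_three] <;>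
    simp [skewVec, lorentzAdj] <;> ring

lemma mdot_lcross_skewVec (g : Matrix (Fin 3) (Fin 3) ℝ) (x y : V3) :
    mdot (lcross (skewVec g) x) y = mdot (g *ᵥ x) y - mdot x (g *ᵥ y) := by
  rw [lcross_skewVec, mdot_sub_left, mdot_lorentzAdj_mulVec]

lemma lcross_left_injective {a b : V3} (hab : ∀ z, lcross a z = lcross b z) : a = b := by
  have h0 := hab ![1, 0, 0]
  have h1 := hab ![0, 1, 0]
  have h01 := congrFun h0 1
  have h02 := congrFun h0 2
  have h12 := congrFun h1 2
  simp [lcross_one, lcross_two] at h01 h02 h12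
  exact V3.ext3 h12 h02 h01

lemma isLorentz.lorentzAdj_mul (hg : isLorentz g) : lorentzAdj g * g = 1 := by
  apply Matrix.mulVec_injective
  funext x
  rw [← Matrix.mulVec_mulVec, Matrix.one_mulVec]
  exact eq_of_forall_mdot fun y => by rw [mdot_lorentzAdj_mulVec, hg]

lemma isLorentz.mul_lorentzAdj (hg : isLorentz g) : g * lorentzAdj g = 1 :=
  mul_eq_one_comm.1 hg.lorentzAdj_mul

lemma isLorentz.mulVec_lorentzAdj (hg : isLorentz g) (x : V3) :
    g *ᵥ (lorentzAdj g *ᵥ x) = x := by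
  rw [Matrix.mulVec_mulVec, hg.mul_lorentzAdj, Matrix.one_mulVec]

lemma isLorentz.lorentzAdj_mulVec (hg : isLorentz g) (x : V3) :
    lorentzAdj g *ᵥ (g *ᵥ x) = x := by
  rw [Matrix.mulVec_mulVec, hg.lorentzAdj_mul, Matrix.one_mulVec]

lemma mdot_lcross_mulVec (g : Matrix (Fin 3) (Fin 3) ℝ) (x y z : V3) :
    mdot (g *ᵥ x) (lcross (g *ᵥ y) (g *ᵥ z)) = g.det * mdot x (lcross y z) := by
  simp only [mdot, lcross_zero, lcross_one, lcross_two, mulVec_apply_fin_three,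
    Matrix.det_fin_three]
  ring

lemma inSO21p.lcross_mulVec (hg : inSO21p g) (x y : V3) :
    lcross (g *ᵥ x) (g *ᵥ y) = g *ᵥ lcross x y := by
  refine eq_of_forall_mdot fun z => ?_
  rw [← hg.1.mulVec_lorentzAdj z, hg.1, mdot_comm, mdot_lcross_mulVec, hg.2.1, one_mul, mdot_comm]

/-- Elements of the identity component preserve the time orientation. -/
lemma inSO21p.time_orientation (hg : inSO21p g) {x : V3} (hx : mdot x x ≤ 0) (hx2 : x 2 ≠ 0) :
    0 < x 2 * (g *ᵥ x) 2 := by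
  have h22 : 0 < g 2 2 := by
    have := hg.2.2
    rw [mulVec_apply_fin_three] at this
    simpa using this
  have hrow : g 2 0 ^ 2 + g 2 1 ^ 2 = g 2 2 ^ 2 - 1 := by
    have := congrFun (congrFun hg.1.mul_lorentzAdj 2) 2
    rw [Matrix.mul_apply, Fin.sum_univ_three] at this
    simp [lorentzAdj] at this
    linarith
  have hx' : x 0 ^ 2 + x 1 ^ 2 ≤ x 2 ^ 2 := by
    simp only [mdot] at hx; linarith
  rw [mulVec_apply_fin_three]
  have hpos : 0 < x 2 ^ 2 := by positivity
  have hcs : (g 2 0 * x 0 + g 2 1 * x 1) ^ 2 ≤ (g 2 2 ^ 2 - 1) * x 2 ^ 2 := by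
    rw [← hrow]
    have : (g 2 0 * x 0 + g 2 1 * x 1) ^ 2 ≤
        (g 2 0 ^ 2 + g 2 1 ^ 2) * (x 0 ^ 2 + x 1 ^ 2) := by
      nlinarith [sq_nonneg (g 2 0 * x 1 - g 2 1 * x 0)]
    exact this.trans (by gcongr)
  have hlt : (x 2 * (g 2 0 * x 0 + g 2 1 * x 1)) ^ 2 < (g 2 2 * x 2 ^ 2) ^ 2 := by
    nlinarith [mul_le_mul_of_nonneg_left hcs hpos.le, mul_pos hpos hpos]
  have := (abs_lt_of_sq_lt_sq' hlt (by positivity)).1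
  nlinarith

lemma inSO21p.mul (hg : inSO21p g) (hh : inSO21p h) : inSO21p (g * h) := by
  refine ⟨fun x y => ?_, by rw [Matrix.det_mul, hg.2.1, hh.2.1, one_mul], ?_⟩
  · rw [← Matrix.mulVec_mulVec, ← Matrix.mulVec_mulVec, hg.1, hh.1]
  · have h0 : mdot (h *ᵥ ![0, 0, 1]) (h *ᵥ ![0, 0, 1]) ≤ 0 := by
      rw [hh.1]; simp [mdot]
    have := hg.time_orientation h0 hh.2.2.ne'
    rw [← Matrix.mulVec_mulVec]
    exact (mul_pos_iff_of_pos_left hh.2.2).1 this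

lemma inSO21p_one : inSO21p (1 : Matrix (Fin 3) (Fin 3) ℝ) :=
  ⟨fun x y => by rw [Matrix.one_mulVec, Matrix.one_mulVec], Matrix.det_one, by simp⟩

lemma inSO21p.pow (hg : inSO21p g) (n : ℕ) : inSO21p (g ^ n) := by
  induction n with
  | zero => rw [pow_zero]; exact inSO21p_one
  | succ n ih => rw [pow_succ]; exact ih.mul hg

lemma inSO21p.mulVec_skewVec (hg : inSO21p g) : g *ᵥ skewVec g = skewVec g := by
  refine lcross_left_injective fun z => ?_
  rw [← hg.1.mulVec_lorentzAdj z, hg.lcross_mulVec, lcross_skewVec, lcross_skewVec,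
    hg.1.lorentzAdj_mulVec, Matrix.mulVec_sub, hg.1.mulVec_lorentzAdj, hg.1.mulVec_lorentzAdj]

lemma isLorentz.mdot_mulVec_of_eigen (hg : isLorentz g) {c : ℝ} (hc : c ≠ 0) {x : V3}
    (hx : g *ᵥ x = c • x) (y : V3) : mdot x (g *ᵥ y) = c⁻¹ * mdot x y := by
  have := hg x y
  rw [hx, mdot_smul_left] at this
  rw [← this, inv_mul_cancel_left₀ hc]

lemma isLorentz.lcross_skewVec_of_eigen (hg : isLorentz g) {c : ℝ} (hc : c ≠ 0) {x : V3}
    (hx : g *ᵥ x = c • x) : lcross (skewVec g) x = (c - c⁻¹) • x := by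
  refine eq_of_forall_mdot fun y => ?_
  rw [mdot_lcross_skewVec, hg.mdot_mulVec_of_eigen hc hx, hx, mdot_smul_left, mdot_smul_left]
  ring

lemma isLorentz.null_of_eigen (hg : isLorentz g) {c : ℝ} (hc : c ^ 2 ≠ 1) {x : V3}
    (hx : g *ᵥ x = c • x) : mdot x x = 0 := by
  have := hg x x
  rw [hx, mdot_smul_left, mdot_smul_right] at this
  have h2 : (c ^ 2 - 1) * mdot x x = 0 := by linarith
  exact (mul_eq_zero.1 h2).resolve_left (sub_ne_zero.2 hc)

lemma inSO21p.det_smul_one_sub (hg : inSO21p g) (c : ℝ) :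
    (c • (1 : Matrix (Fin 3) (Fin 3) ℝ) - g).det =
      (c - 1) * (c ^ 2 - (g.trace - 1) * c + 1) := by
  have h0 := congrFun (hg.lcross_mulVec ![0, 1, 0] ![0, 0, 1]) 0
  have h1 := congrFun (hg.lcross_mulVec ![0, 0, 1] ![1, 0, 0]) 1
  have h2 := congrFun (hg.lcross_mulVec ![1, 0, 0] ![0, 1, 0]) 2
  have hd := hg.2.1
  simp [lcross_zero, lcross_one, lcross_two, mulVec_apply_fin_three] at h0 h1 h2
  rw [Matrix.det_fin_three] at hd ⊢
  rw [Matrix.trace_fin_three]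
  simp
  linear_combination -hd + c * (h0 + h1 - h2)

lemma exists_eigenvector {c : ℝ} (hdet : (c • (1 : Matrix (Fin 3) (Fin 3) ℝ) - g).det = 0) :
    ∃ x : V3, x ≠ 0 ∧ g *ᵥ x = c • x := by
  obtain ⟨x, hx0, hx⟩ := Matrix.exists_mulVec_eq_zero_iff.2 hdet
  refine ⟨x, hx0, ?_⟩
  rw [Matrix.sub_mulVec, Matrix.smul_mulVec, Matrix.one_mulVec, sub_eq_zero] at hx
  exact hx.symm

lemma inSO21p.exists_hypData (hg : inSO21p g) (htr : 3 < g.trace) {γ : Equiv.Perm V3} {u : V3}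
    (hγ : ∀ x, γ x = g *ᵥ x + u) :
    ∃ e f l, HypData γ (skewVec g) e f l (mdot (skewVec g) u) := by
  obtain ⟨l, hl1, hl⟩ : ∃ l : ℝ, 1 < l ∧ l ^ 2 - (g.trace - 1) * l + 1 = 0 := by
    have hD : 0 < (g.trace - 1) ^ 2 - 4 := by nlinarith
    refine ⟨((g.trace - 1) + Real.sqrt ((g.trace - 1) ^ 2 - 4)) / 2, ?_, ?_⟩
    · linarith [Real.sqrt_nonneg ((g.trace - 1) ^ 2 - 4)]
    · linear_combination (1 / 4 : ℝ) * Real.sq_sqrt hD.le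
  have hl0 : l ≠ 0 := by linarith
  have hlinv : l⁻¹ < 1 := inv_lt_one_of_one_lt₀ hl1
  have hlpos : 0 < l⁻¹ := by positivity
  obtain ⟨e, he0, he⟩ := exists_eigenvector (g := g) (c := l)
    (by rw [hg.det_smul_one_sub, hl, mul_zero])
  obtain ⟨f, hf0, hf⟩ := exists_eigenvector (g := g) (c := l⁻¹) (by
    rw [hg.det_smul_one_sub]
    have : l⁻¹ ^ 2 - (g.trace - 1) * l⁻¹ + 1 = l⁻¹ ^ 2 * (l ^ 2 - (g.trace - 1) * l + 1) := by
      field_simp; ring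
    rw [this, hl, mul_zero, mul_zero])
  have hen := hg.1.null_of_eigen (by nlinarith) he
  have hfn := hg.1.null_of_eigen (by nlinarith) hf
  refine ⟨e, f, l, hl1, fun x => ?_, fun x y => ?_, fun x y => ?_, ⟨l - l⁻¹, by linarith, ?_⟩,
    ⟨l - l⁻¹, by linarith, ?_⟩, fun hef => ?_⟩
  · rw [hγ, mdot_add_right]
    nth_rewrite 1 [← hg.mulVec_skewVec]
    rw [hg.1]
  · rw [hγ, hγ, add_sub_add_right_eq_sub, ← Matrix.mulVec_sub, hg.1.mdot_mulVec_of_eigen hl0 he]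
  · rw [hγ, hγ, add_sub_add_right_eq_sub, ← Matrix.mulVec_sub,
      hg.1.mdot_mulVec_of_eigen hlpos.ne' hf, inv_inv]
  · exact hg.1.lcross_skewVec_of_eigen hl0 he
  · rw [hg.1.lcross_skewVec_of_eigen hlpos.ne' hf, inv_inv, neg_sub]
  · obtain ⟨t, ht⟩ := null_parallel hen hfn hef hf0
    have h1 : g *ᵥ e = l⁻¹ • e := by rw [ht, Matrix.mulVec_smul, hf, smul_comm]
    rw [he] at h1
    have := smul_left_injective ℝ he0 h1
    linarith

lemma eval_charpoly_eq_det (g : Matrix (Fin 3) (Fin 3) ℝ) (c : ℝ) :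
    g.charpoly.eval c = (c • (1 : Matrix (Fin 3) (Fin 3) ℝ) - g).det := by
  rw [Matrix.eval_charpoly, Matrix.smul_one_eq_diagonal]; rfl

lemma inSO21p.three_lt_trace (hg : inSO21p g) (hh : isHyperbolic g) : 3 < g.trace := by
  obtain ⟨a, b, c, hab, hac, hbc, hp⟩ := hh
  have hroot : ∀ x, (x - a) * (x - b) * (x - c) = 0 →
      (x - 1) * (x ^ 2 - (g.trace - 1) * x + 1) = 0 := by
    intro x hx
    rw [← hg.det_smul_one_sub, ← eval_charpoly_eq_det, hp]
    simpa using hx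
  obtain ⟨x, hx, hx1, hx2⟩ : ∃ x, (x - a) * (x - b) * (x - c) = 0 ∧ x ≠ 1 ∧ x ≠ -1 := by
    by_contra! hcon
    have ha := hcon a (by ring)
    have hb := hcon b (by ring)
    have hc := hcon c (by ring)
    by_cases ha1 : a = 1
    · exact hbc ((hb (ha1 ▸ hab.symm)).trans (hc (ha1 ▸ hac.symm)).symm)
    · by_cases hb1 : b = 1
      · exact hac ((ha ha1).trans (hc (hb1 ▸ hbc.symm)).symm)
      · exact hab ((ha ha1).trans (hb hb1).symm)
  have hx' := hroot x hx
  have hq := (mul_eq_zero.1 hx').resolve_left (sub_ne_zero.2 hx1)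
  have hsq : x ^ 2 ≠ 1 := by
    intro h
    have h0 : (x - 1) * (x + 1) = 0 := by linear_combination h
    rcases mul_eq_zero.1 h0 with h0 | h0
    · exact hx1 (by linarith)
    · exact hx2 (by linarith)
  obtain ⟨v, hv0, hv⟩ := exists_eigenvector (g := g) (c := x) (by rw [hg.det_smul_one_sub, hx'])
  have hn := hg.1.null_of_eigen hsq hv
  have h2 := third_ne_zero hn.le hv0
  have hpos := hg.time_orientation hn.le h2
  rw [hv, Pi.smul_apply, smul_eq_mul] at hpos
  have hxpos : 0 < x := by
    have : 0 < x * v 2 ^ 2 := by linarith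
    exact (mul_pos_iff_of_pos_right (by positivity)).1 this
  have : 0 < (x - 1) ^ 2 := by have := sub_ne_zero.2 hx1; positivity
  nlinarith

end Lorentz

section Parabolic

variable {g : Matrix (Fin 3) (Fin 3) ℝ}

/-- The normal form of a parabolic isometry: the exponential of `x ↦ e × x`, `e` null. -/
structure IsParabolicWith (g : Matrix (Fin 3) (Fin 3) ℝ) (e : V3) : Prop where
  ne_zero : e ≠ 0
  null : mdot e e = 0
  mulVec_eq : ∀ x, g *ᵥ x = x + lcross e x - (mdot e x / 2) • e

lemma inSO21p.exists_isParabolicWith (hg : inSO21p g) (hp : isParabolic g) :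
    ∃ e, IsParabolicWith g e ∧ skewVec g = (2 : ℝ) • e := by
  obtain ⟨hg1, hchar⟩ := hp
  obtain ⟨M, hM⟩ : ∃ M, M = g - 1 := ⟨_, rfl⟩
  have hgM : g = 1 + M := by rw [hM]; abel
  have hM3 : M * M * M = 0 := by
    have := Matrix.aeval_self_charpoly g
    rw [hchar] at this
    simp only [map_pow, map_sub, Polynomial.aeval_X, map_one] at this
    rw [hM]; rw [pow_three'] at this; exact this
  have hadj : lorentzAdj g = 1 - M + M * M := by
    have h1 : g * (1 - M + M * M) = 1 := by
      rw [hgM]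
      have : (1 + M) * (1 - M + M * M) = 1 + M * M * M := by noncomm_ring
      rw [this, hM3, add_zero]
    calc lorentzAdj g = lorentzAdj g * (g * (1 - M + M * M)) := by rw [h1, mul_one]
      _ = _ := by rw [← mul_assoc, hg.1.lorentzAdj_mul, one_mul]
  obtain ⟨P, hP⟩ : ∃ P, P = M - (1 / 2 : ℝ) • (M * M) := ⟨_, rfl⟩
  have hPP : P * P = M * M := by
    have h1 : P * P = M * M - (1 / 2 : ℝ) • (M * M * M) - (1 / 2 : ℝ) • (M * M * M)
        + (1 / 4 : ℝ) • (M * M * M * M) := by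
      rw [hP]
      simp only [sub_mul, mul_sub, smul_mul_assoc, mul_smul_comm, mul_assoc]
      module
    rw [h1, hM3]; simp
  obtain ⟨e, he⟩ : ∃ e, e = (1 / 2 : ℝ) • skewVec g := ⟨_, rfl⟩
  have hcross : ∀ x, lcross e x = P *ᵥ x := by
    intro x
    rw [he, lcross_smul_left, lcross_skewVec, hadj, ← Matrix.sub_mulVec, ← Matrix.smul_mulVec]
    congr 1
    rw [hP, hgM]
    module
  have hcross2 : ∀ x, lcross e (lcross e x) = (M * M) *ᵥ x := by
    intro x
    rw [hcross, hcross, Matrix.mulVec_mulVec, hPP]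
  have hform : ∀ x, g *ᵥ x = x + lcross e x + (1 / 2 : ℝ) • lcross e (lcross e x) := by
    intro x
    rw [hcross2, hcross, ← Matrix.smul_mulVec]
    nth_rewrite 2 [← Matrix.one_mulVec x]
    rw [← Matrix.add_mulVec, ← Matrix.add_mulVec]
    congr 1
    rw [hP, hgM]
    module
  have he0 : e ≠ 0 := by
    rintro h0
    apply hg1
    apply Matrix.mulVec_injective
    funext x
    have hz : ∀ y, lcross e y = 0 := fun y => by
      rw [h0]; apply V3.ext3 <;> simp [lcross_zero, lcross_one, lcross_two]
    rw [hform, hz, hz, Matrix.one_mulVec]; simp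
  have hnull : mdot e e = 0 := by
    by_contra hne
    apply he0
    refine lcross_left_injective fun x => ?_
    have h3 : lcross e (lcross e (lcross e x)) = 0 := by
      rw [hcross2, hcross, Matrix.mulVec_mulVec, hP]
      have : M * M * (M - (1 / 2 : ℝ) • (M * M)) = 0 := by
        rw [mul_sub, mul_smul_comm, ← mul_assoc, hM3]; simp
      rw [this, Matrix.zero_mulVec]
    rw [lcross_lcross, mdot_lcross_self_left, zero_smul, sub_zero] at h3
    rw [(smul_eq_zero.1 h3).resolve_left hne]
    apply V3.ext3 <;> simp [lcross_zero, lcross_one, lcross_two]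
  refine ⟨e, ⟨he0, hnull, fun x => ?_⟩, ?_⟩
  · rw [hform, lcross_lcross, hnull]
    module
  · rw [he, smul_smul]; norm_num

lemma inSO21p.mdot_skewVec_pos (hg : inSO21p g) (htr : 3 < g.trace) :
    0 < mdot (skewVec g) (skewVec g) := by
  obtain ⟨e, f, l, hd⟩ := hg.exists_hypData htr
    (γ := ⟨fun x => g *ᵥ x, fun x => lorentzAdj g *ᵥ x, hg.1.lorentzAdj_mulVec,
      hg.1.mulVec_lorentzAdj⟩) (u := 0) (fun x => (add_zero _).symm)
  exact hd.mdot_neutral_pos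

lemma inSO21p.skewVec_ne_zero (hg : inSO21p g) (ht : isHyperbolic g ∨ isParabolic g) :
    skewVec g ≠ 0 := by
  rcases ht with ht | ht
  · intro h0
    have := hg.mdot_skewVec_pos (hg.three_lt_trace ht)
    rw [h0, mdot_zero_left] at this
    exact this.false
  · obtain ⟨e, he, hF⟩ := hg.exists_isParabolicWith ht
    rw [hF]
    exact smul_ne_zero two_ne_zero he.ne_zero

/-- The positive fixed vectors of `g` are the positive multiples of `skewVec g`. -/
lemma inSO21p.skewVec_of_positiveFixed (hg : inSO21p g) (ht : isHyperbolic g ∨ isParabolic g)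
    {v : V3} (hv : positiveFixed g v) : ∃ t : ℝ, 0 < t ∧ skewVec g = t • v := by
  obtain ⟨hv0, hgv, x, hx, hne, hpos⟩ := hv
  have hcr : lcross (skewVec g) v = 0 := by
    have h1 : g *ᵥ v = (1 : ℝ) • v := by rw [one_smul, hgv]
    rw [hg.1.lcross_skewVec_of_eigen one_ne_zero h1]; simp
  obtain ⟨t, ht'⟩ := exists_smul_of_lcross_eq_zero hcr hv0
  have ht0 : t ≠ 0 := by
    rintro rfl
    exact hg.skewVec_ne_zero ht (by rw [ht', zero_smul])
  refine ⟨t, lt_of_le_of_ne ?_ ht0.symm, ht'⟩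
  have h1 : t * mdot v (lcross x (g *ᵥ x)) = mdot x x - mdot x (g *ᵥ (g *ᵥ x)) := by
    rw [← mdot_smul_left, ← ht', mdot_lcross_cycle, mdot_lcross_skewVec, hg.1]
  have hx0 : x ≠ 0 := by
    rintro rfl
    exact hne 0 (by simp)
  have hx2 := third_ne_zero hx hx0
  have h2 := hg.time_orientation hx hx2
  have hgx : mdot (g *ᵥ x) (g *ᵥ x) ≤ 0 := by rwa [hg.1]
  have h3 := hg.time_orientation hgx (right_ne_zero_of_mul h2.ne')
  have h4 : 0 ≤ x 2 * (g *ᵥ (g *ᵥ x)) 2 := by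
    by_contra! hlt
    nlinarith [mul_pos h2 h3, mul_nonneg_of_nonpos_of_nonpos hlt.le
      (neg_nonpos.2 (sq_nonneg ((g *ᵥ x) 2)))]
  have h5 := mdot_le_of_causal hx (by rw [hg.1, hg.1]) h4
  have h6 : 0 ≤ t * mdot v (lcross x (g *ᵥ x)) := by rw [h1]; linarith
  exact nonneg_of_mul_nonneg_left h6 hpos

lemma IsParabolicWith.pow_apply {e u : V3} {γ : Equiv.Perm V3} (hg : IsParabolicWith g e)
    (hγ : ∀ x, γ x = g *ᵥ x + u) (n : ℕ) (x : V3) :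
    (γ ^ n) x = x + (n : ℝ) • lcross e x - (n ^ 2 / 2 * mdot e x) • e + (n : ℝ) • u
      + ((n ^ 2 - n) / 2 : ℝ) • lcross e u
      - ((2 * n ^ 3 - 3 * n ^ 2 + n) / 12 * mdot e u : ℝ) • e := by
  have hn := hg.null
  induction n with
  | zero => simp
  | succ n ih =>
    rw [pow_succ', Equiv.Perm.mul_apply, hγ, ih, hg.mulVec_eq]
    simp only [lcross_add_right, lcross_sub_right, lcross_smul_right, lcross_self, lcross_lcross,
      mdot_add_right, mdot_sub_right, mdot_smul_right, mdot_lcross_self_left, hn]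
    push_cast
    module

lemma IsParabolicWith.pow_mulVec {e : V3} (hg : IsParabolicWith g e) (n : ℕ) (x : V3) :
    (g ^ n) *ᵥ x = x + (n : ℝ) • lcross e x - (n ^ 2 / 2 * mdot e x) • e := by
  have hn := hg.null
  induction n with
  | zero => simp
  | succ n ih =>
    rw [pow_succ', ← Matrix.mulVec_mulVec, ih, hg.mulVec_eq]
    simp only [lcross_add_right, lcross_sub_right, lcross_smul_right, lcross_self, lcross_lcross,
      mdot_add_right, mdot_sub_right, mdot_smul_right, mdot_lcross_self_left, hn]
    push_cast
    module

/-- `skewVec` and trace of `g` followed by a parabolic-type map. -/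
lemma skewVec_trace_of_mulVec_eq {G : Matrix (Fin 3) (Fin 3) ℝ} {e : V3} {a b : ℝ}
    (hG : ∀ x, G *ᵥ x = g *ᵥ x + a • lcross e (g *ᵥ x) - (b * mdot e (g *ᵥ x)) • e) :
    skewVec G = skewVec g + a • (g.trace • e - g *ᵥ e) - b • lcross e (lorentzAdj g *ᵥ e) ∧
    G.trace = g.trace + a * mdot e (skewVec g) - b * mdot e (g *ᵥ e) := by
  have hentry : ∀ i j, G i j = (G *ᵥ Pi.single j 1) i := fun i j => by simp
  have hG' : G = fun i j => (g *ᵥ Pi.single j 1 + a • lcross e (g *ᵥ Pi.single j 1)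
      - (b * mdot e (g *ᵥ Pi.single j 1)) • e) i := by
    ext i j
    rw [hentry, hG]
  constructor
  · rw [Matrix.trace_fin_three]
    apply V3.ext3 <;> simp only [Pi.add_apply, Pi.sub_apply, Pi.smul_apply, smul_eq_mul,
        lcross_zero, lcross_one, lcross_two, mulVec_apply_fin_three] <;>
      simp [hG', skewVec, lorentzAdj, mdot, lcross_zero, lcross_one, lcross_two] <;> ring
  · rw [Matrix.trace_fin_three, Matrix.trace_fin_three]
    simp only [mdot, mulVec_apply_fin_three]
    simp [hG', skewVec, mdot, lcross_zero, lcross_one, lcross_two]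
    ring

lemma exists_forall_ge_quadratic_pos {c : ℝ} (hc : 0 < c) (c₁ c₀ : ℝ) :
    ∃ N : ℕ, ∀ n : ℕ, N ≤ n → 0 < c * n ^ 2 + c₁ * n + c₀ := by
  obtain ⟨N, hN⟩ := exists_nat_gt (1 + (|c₁| + |c₀|) / c)
  refine ⟨N, fun n hn => ?_⟩
  have hn' : 1 + (|c₁| + |c₀|) / c < n := hN.trans_le (by exact_mod_cast hn)
  have h1 : (1 : ℝ) < n := lt_of_le_of_lt (by have : 0 ≤ (|c₁| + |c₀|) / c := by positivity
                                              linarith) hn'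
  have h2 : |c₁| + |c₀| < c * n := by
    have : (|c₁| + |c₀|) / c < n := by linarith
    rw [div_lt_iff₀ hc] at this; linarith
  nlinarith [neg_abs_le c₁, neg_abs_le c₀, abs_nonneg c₀,
    mul_nonneg (abs_nonneg c₀) (sub_nonneg.2 h1.le),
    mul_nonneg (sub_nonneg.2 (neg_abs_le c₁)) (by linarith : (0 : ℝ) ≤ n)]

lemma exists_forall_ge_quartic_pos {c : ℝ} (hc : 0 < c) (c₃ c₂ c₁ c₀ : ℝ) :
    ∃ N : ℕ, ∀ n : ℕ, N ≤ n → 0 < c * n ^ 4 + c₃ * n ^ 3 + c₂ * n ^ 2 + c₁ * n + c₀ := by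
  obtain ⟨N₁, hN₁⟩ := exists_forall_ge_quadratic_pos (half_pos hc) c₃ (c₂ - 1)
  obtain ⟨N₂, hN₂⟩ := exists_forall_ge_quadratic_pos one_pos c₁ c₀
  refine ⟨max N₁ N₂, fun n hn => ?_⟩
  have h1 := hN₁ n (le_of_max_le_left hn)
  have h2 := hN₂ n (le_of_max_le_right hn)
  nlinarith [mul_nonneg (sq_nonneg (n : ℝ)) h1.le, sq_nonneg ((n : ℝ) ^ 2)]

end Parabolic

section Reduction

variable {g1 g2 : Matrix (Fin 3) (Fin 3) ℝ} {u1 u2 e : V3} {γ1 γ2 : Equiv.Perm V3}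

/-- The product of the `n`-th power of a parabolic affine isometry with another affine isometry
`x ↦ g2 x + u2`: its affine form, its trace and its Margulis invariant with respect to
`skewVec`. -/
lemma IsParabolicWith.pow_mul_apply (hp : IsParabolicWith g1 e)
    (hγ1 : ∀ x, γ1 x = g1 *ᵥ x + u1) (hγ2 : ∀ x, γ2 x = g2 *ᵥ x + u2) (n : ℕ) :
    ∃ W, (∀ x, (γ1 ^ n * γ2) x = (g1 ^ n * g2) *ᵥ x + W) ∧
      (g1 ^ n * g2).trace = g2.trace + n * mdot e (skewVec g2) - n ^ 2 / 2 * mdot e (g2 *ᵥ e) ∧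
      mdot (skewVec (g1 ^ n * g2)) W =
        mdot (skewVec g2 + (n : ℝ) • (g2.trace • e - g2 *ᵥ e)
          - (n ^ 2 / 2 : ℝ) • lcross e (lorentzAdj g2 *ᵥ e))
        (u2 + (n : ℝ) • (lcross e u2 + u1 - (1 / 2 : ℝ) • lcross e u1 - (mdot e u1 / 12) • e)
          + (n ^ 2 : ℝ) • ((1 / 2 : ℝ) • lcross e u1 + (mdot e u1 / 4) • e - (mdot e u2 / 2) • e)
          - (n ^ 3 * mdot e u1 / 6 : ℝ) • e) := by
  obtain ⟨hF, ht⟩ := skewVec_trace_of_mulVec_eq (g := g2) (G := g1 ^ n * g2) (e := e) (a := n)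
    (b := n ^ 2 / 2) (fun x => by rw [← Matrix.mulVec_mulVec, hp.pow_mulVec])
  refine ⟨_, fun x => ?_, ht, by rw [hF]⟩
  rw [Equiv.Perm.mul_apply, hp.pow_apply hγ1, hγ2, ← Matrix.mulVec_mulVec, hp.pow_mulVec]
  simp only [lcross_add_right, mdot_add_right]
  module

/-- If the linear part of `γ2` moves the null direction of the parabolic `γ1`, then a suitable
`γ1 ^ n * γ2` is hyperbolic with the sign of `γ1`. -/
lemma IsParabolicWith.exists_hyperbolic_of_mdot_neg (hp : IsParabolicWith g1 e)
    (hγ1 : ∀ x, γ1 x = g1 *ᵥ x + u1) (hγ2 : ∀ x, γ2 x = g2 *ᵥ x + u2)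
    (hs : mdot e u1 ≠ 0) (hd : mdot e (g2 *ᵥ e) < 0) :
    ∃ (n : ℕ) (W : V3), 3 < (g1 ^ n * g2).trace ∧ (∀ x, (γ1 ^ n * γ2) x = (g1 ^ n * g2) *ᵥ x + W) ∧
      0 < mdot e u1 * mdot (skewVec (g1 ^ n * g2)) W := by
  have hB : ∀ y, mdot (lcross e (lorentzAdj g2 *ᵥ e)) (lcross e y) =
      mdot e y * mdot e (g2 *ᵥ e) := fun y => by
    rw [mdot_lcross_lcross, hp.null, mdot_lorentzAdj_mulVec]; ring
  have hBe : mdot (lcross e (lorentzAdj g2 *ᵥ e)) e = 0 := by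
    rw [mdot_comm, mdot_lcross_self_left]
  have hc : 0 < mdot e u1 ^ 2 * (-mdot e (g2 *ᵥ e)) / 12 := by
    have := neg_pos.2 hd
    positivity
  obtain ⟨N₁, hN₁⟩ := exists_forall_ge_quadratic_pos (c := -mdot e (g2 *ᵥ e) / 2) (by linarith)
    (mdot e (skewVec g2)) (g2.trace - 3)
  set F := skewVec g2
  set A := g2.trace • e - g2 *ᵥ e with hA
  set B := lcross e (lorentzAdj g2 *ᵥ e)
  set s := mdot e u1 with hs'
  set W₁ := lcross e u2 + u1 - (1 / 2 : ℝ) • lcross e u1 - (s / 12) • e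
  set W₂ := (1 / 2 : ℝ) • lcross e u1 + (s / 4) • e - (mdot e u2 / 2) • e with hW₂
  have hAe : mdot A e = -mdot e (g2 *ᵥ e) := by
    rw [hA, mdot_sub_left, mdot_smul_left, hp.null, mdot_comm (g2 *ᵥ e)]; ring
  have hBW : mdot B W₂ = s * mdot e (g2 *ᵥ e) / 2 := by
    rw [hW₂, mdot_sub_right, mdot_add_right, mdot_smul_right, mdot_smul_right, mdot_smul_right,
      hB, hBe]; ring
  obtain ⟨N₂, hN₂⟩ := exists_forall_ge_quartic_pos hc
    (s * (mdot A W₂ - s / 6 * mdot F e - mdot B W₁ / 2))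
    (s * (mdot A W₁ + mdot F W₂ - mdot B u2 / 2)) (s * (mdot A u2 + mdot F W₁)) (s * mdot F u2)
  obtain ⟨W, hW, ht, hm⟩ := hp.pow_mul_apply hγ1 hγ2 (max N₁ N₂)
  change _ = mdot (F + _ • A - _ • B) (u2 + _ • W₁ + _ • W₂ - (_ * s / 6) • e) at hm
  refine ⟨max N₁ N₂, W, ?_, hW, ?_⟩
  · rw [ht]; linarith [hN₁ _ (le_max_left N₁ N₂)]
  · rw [hm]
    convert hN₂ _ (le_max_right N₁ N₂) using 1
    simp only [mdot_add_left, mdot_sub_left, mdot_smul_left, mdot_add_right, mdot_sub_right,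
      mdot_smul_right, hAe, hBW, hBe]
    ring

/-- If `γ2` is hyperbolic and its linear part fixes the null direction of the parabolic `γ1`,
then a suitable `γ1 ^ n * γ2` is hyperbolic with the sign of `γ1`. -/
lemma IsParabolicWith.exists_hyperbolic_of_eigen (hp : IsParabolicWith g1 e)
    (hg2 : inSO21p g2)
    (hγ1 : ∀ x, γ1 x = g1 *ᵥ x + u1) (hγ2 : ∀ x, γ2 x = g2 *ᵥ x + u2)
    (hs : mdot e u1 ≠ 0) (htr : 3 < g2.trace) {m : ℝ} (hm : 0 < m) (he : g2 *ᵥ e = m • e)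
    (hmt : g2.trace = 1 + m + m⁻¹) (hF : mdot (skewVec g2) e = 0) :
    ∃ (n : ℕ) (W : V3), 3 < (g1 ^ n * g2).trace ∧ (∀ x, (γ1 ^ n * γ2) x = (g1 ^ n * g2) *ᵥ x + W) ∧
      0 < mdot e u1 * mdot (skewVec (g1 ^ n * g2)) W := by
  have hadj : lorentzAdj g2 *ᵥ e = m⁻¹ • e := by
    have := hg2.1.lorentzAdj_mulVec e
    rw [he, Matrix.mulVec_smul] at this
    rw [← this, smul_smul, inv_mul_cancel₀ hm.ne', one_smul, this]
  have hB : lcross e (lorentzAdj g2 *ᵥ e) = 0 := by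
    rw [hadj, lcross_smul_right, lcross_self, smul_zero]
  have hA : g2.trace • e - g2 *ᵥ e = (1 + m⁻¹) • e := by rw [he, hmt]; module
  have hFc : mdot (skewVec g2) (lcross e u1) = (m - m⁻¹) * mdot e u1 := by
    rw [mdot_lcross_cycle, hg2.1.lcross_skewVec_of_eigen hm.ne' he, mdot_smul_left]
  have hc : 0 < mdot e u1 ^ 2 * (1 + (m + m⁻¹) / 2) := by positivity
  set W₁ := lcross e u2 + u1 - (1 / 2 : ℝ) • lcross e u1 - (mdot e u1 / 12) • e with hW₁
  have heW : mdot e W₁ = mdot e u1 := by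
    rw [hW₁]
    simp only [mdot_add_right, mdot_sub_right, mdot_smul_right, mdot_lcross_self_left, hp.null]
    ring
  obtain ⟨N, hN⟩ := exists_forall_ge_quadratic_pos hc
    (mdot e u1 * (mdot (skewVec g2) W₁ + (1 + m⁻¹) * mdot e u2))
    (mdot e u1 * mdot (skewVec g2) u2)
  obtain ⟨W, hW, ht, hm⟩ := hp.pow_mul_apply hγ1 hγ2 N
  refine ⟨N, W, ?_, hW, ?_⟩
  · rw [ht, he, mdot_smul_right, hp.null, mdot_comm, hF]; linarith
  · rw [hm]
    convert hN _ le_rfl using 1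
    rw [hB, hA, ← hW₁]
    simp only [mdot_add_left, mdot_sub_left, mdot_smul_left, mdot_add_right, mdot_sub_right,
      mdot_smul_right, smul_zero, mdot_zero_left, hF, hFc, heW, mdot_lcross_self_left, hp.null]
    ring

/-- If `γ1` is parabolic and `γ2` hyperbolic, then a suitable `γ1 ^ n * γ2` is hyperbolic with the
sign of `γ1`. -/
lemma IsParabolicWith.exists_hyperbolic (hp : IsParabolicWith g1 e) (hg2 : inSO21p g2)
    (hγ1 : ∀ x, γ1 x = g1 *ᵥ x + u1) (hγ2 : ∀ x, γ2 x = g2 *ᵥ x + u2)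
    (hs : mdot e u1 ≠ 0) (htr : 3 < g2.trace) :
    ∃ (n : ℕ) (W : V3), 3 < (g1 ^ n * g2).trace ∧ (∀ x, (γ1 ^ n * γ2) x = (g1 ^ n * g2) *ᵥ x + W) ∧
      0 < mdot e u1 * mdot (skewVec (g1 ^ n * g2)) W := by
  have he2 : e 2 ≠ 0 := third_ne_zero hp.null.le hp.ne_zero
  have hor := hg2.time_orientation hp.null.le he2
  have hnull : mdot (g2 *ᵥ e) (g2 *ᵥ e) = mdot e e := hg2.1 e e
  have hd : mdot e (g2 *ᵥ e) ≤ 0 := hp.null ▸ mdot_le_of_causal hp.null.le hnull hor.le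
  rcases hd.lt_or_eq with hd | hd
  · exact hp.exists_hyperbolic_of_mdot_neg hγ1 hγ2 hs hd
  obtain ⟨m, hm⟩ := null_parallel (hnull.trans hp.null) hp.null (by rw [mdot_comm, hd])
    hp.ne_zero
  have hm0 : 0 < m := by
    rw [hm, Pi.smul_apply, smul_eq_mul] at hor
    have : 0 < e 2 * e 2 := mul_self_pos.2 he2
    by_contra! h
    nlinarith
  have hcr := hg2.1.lcross_skewVec_of_eigen hm0.ne' hm
  have hm1 : m ≠ 1 := by
    rintro rfl
    rw [inv_one, sub_self, zero_smul] at hcr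
    obtain ⟨t, ht⟩ := exists_smul_of_lcross_eq_zero hcr hp.ne_zero
    have := hg2.mdot_skewVec_pos htr
    rw [ht, mdot_smul_left, mdot_smul_right, hp.null] at this
    simp at this
  have hmm : m - m⁻¹ ≠ 0 := by
    intro h
    have h1 : m * m⁻¹ = 1 := mul_inv_cancel₀ hm0.ne'
    have h2 : (m - 1) * (m + 1) = 0 := by linear_combination m * h + h1
    rcases mul_eq_zero.1 h2 with h3 | h3
    · exact hm1 (by linarith)
    · linarith
  refine hp.exists_hyperbolic_of_eigen hg2 hγ1 hγ2 hs htr hm0 hm ?_ ?_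
  · have h0 : (m • (1 : Matrix (Fin 3) (Fin 3) ℝ) - g2).det = 0 :=
      Matrix.exists_mulVec_eq_zero_iff.1 ⟨e, hp.ne_zero, by
        rw [Matrix.sub_mulVec, Matrix.smul_mulVec, Matrix.one_mulVec, hm, sub_self]⟩
    rw [hg2.det_smul_one_sub] at h0
    have h1 := (mul_eq_zero.1 h0).resolve_left (sub_ne_zero.2 hm1)
    field_simp
    linarith
  · have h := mdot_lcross_self_left (skewVec g2) e
    rw [hcr, mdot_smul_right] at h
    exact (mul_eq_zero.1 h).resolve_left hmm

lemma not_properlyDisc_of_hyperbolic_of_hyperbolic {Γ : Subgroup (Equiv.Perm V3)}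
    (hΓ1 : γ1 ∈ Γ) (hΓ2 : γ2 ∈ Γ) (hg1 : inSO21p g1) (hg2 : inSO21p g2)
    (hγ1 : ∀ x, γ1 x = g1 *ᵥ x + u1) (hγ2 : ∀ x, γ2 x = g2 *ᵥ x + u2)
    (ht1 : 3 < g1.trace) (ht2 : 3 < g2.trace)
    (hs : mdot (skewVec g1) u1 * mdot (skewVec g2) u2 < 0) : ¬ properlyDisc Γ := by
  obtain ⟨_, _, _, h1⟩ := hg1.exists_hypData ht1 hγ1
  obtain ⟨_, _, _, h2⟩ := hg2.exists_hypData ht2 hγ2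
  exact h1.not_properlyDisc hΓ1 hΓ2 h2 hs

lemma mul_neg_of_mul_pos_of_mul_neg {a b c : ℝ} (hab : 0 < a * b) (hac : a * c < 0) :
    b * c < 0 := by
  rcases pos_and_pos_or_neg_and_neg_of_mul_pos hab with ⟨ha, hb⟩ | ⟨ha, hb⟩
  · exact mul_neg_of_pos_of_neg hb (neg_of_mul_neg_right hac ha.le)
  · exact mul_neg_of_neg_of_pos hb (pos_of_mul_neg_right hac ha.le)

lemma not_properlyDisc_of_parabolic_of_hyperbolic {Γ : Subgroup (Equiv.Perm V3)}
    (hΓ1 : γ1 ∈ Γ) (hΓ2 : γ2 ∈ Γ) (hg1 : inSO21p g1) (hg2 : inSO21p g2)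
    (hγ1 : ∀ x, γ1 x = g1 *ᵥ x + u1) (hγ2 : ∀ x, γ2 x = g2 *ᵥ x + u2)
    (hp : IsParabolicWith g1 e) (ht2 : 3 < g2.trace)
    (hs : mdot e u1 * mdot (skewVec g2) u2 < 0) : ¬ properlyDisc Γ := by
  obtain ⟨n, W, htr, hW, hpos⟩ :=
    hp.exists_hyperbolic hg2 hγ1 hγ2 (left_ne_zero_of_mul hs.ne) ht2
  exact not_properlyDisc_of_hyperbolic_of_hyperbolic
    (Γ.mul_mem (Γ.pow_mem hΓ1 n) hΓ2) hΓ2 ((hg1.pow n).mul hg2) hg2 hW hγ2 htr ht2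
    (mul_neg_of_mul_pos_of_mul_neg hpos hs)

/-- Two parabolics of opposite signs with distinct null directions. -/
lemma not_properlyDisc_of_parabolic_of_parabolic {Γ : Subgroup (Equiv.Perm V3)} {e' : V3}
    (hΓ1 : γ1 ∈ Γ) (hΓ2 : γ2 ∈ Γ) (hg1 : inSO21p g1) (hg2 : inSO21p g2)
    (hγ1 : ∀ x, γ1 x = g1 *ᵥ x + u1) (hγ2 : ∀ x, γ2 x = g2 *ᵥ x + u2)
    (hp : IsParabolicWith g1 e) (hp' : IsParabolicWith g2 e') (hee : mdot e e' ≠ 0)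
    (hs : mdot e u1 * mdot e' u2 < 0) : ¬ properlyDisc Γ := by
  have hd : mdot e (g2 *ᵥ e) < 0 := by
    have : 0 < mdot e e' ^ 2 := by positivity
    rw [hp'.mulVec_eq, mdot_sub_right, mdot_add_right, mdot_lcross_self_right, hp.null,
      mdot_smul_right, mdot_comm e' e]
    linarith
  obtain ⟨n, W, htr, hW, hpos⟩ :=
    hp.exists_hyperbolic_of_mdot_neg hγ1 hγ2 (left_ne_zero_of_mul hs.ne) hd
  refine not_properlyDisc_of_parabolic_of_hyperbolic hΓ2 (Γ.mul_mem (Γ.pow_mem hΓ1 n) hΓ2) hg2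
    ((hg1.pow n).mul hg2) hγ2 hW hp' htr ?_
  rw [mul_comm]
  exact mul_neg_of_mul_pos_of_mul_neg hpos hs

end Reduction

section ParallelParabolics

/-- A homeomorphism shifting the linear form `e` by `s` and whose linear part shears the linear
form `r` by `j` times `e`. -/
structure ShearData (h : Equiv.Perm V3) (e r : V3) (j s : ℝ) : Prop where
  mdot_apply : ∀ x, mdot e (h x) = mdot e x + s
  mdot_sub : ∀ x y, mdot r (h x - h y) = mdot r (x - y) + j * mdot e (x - y)

namespace ShearData

variable {h h' : Equiv.Perm V3} {e r : V3} {j j' s s' : ℝ}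

lemma mul (hh : ShearData h e r j s) (hh' : ShearData h' e r j' s') :
    ShearData (h * h') e r (j + j') (s + s') where
  mdot_apply x := by rw [Equiv.Perm.mul_apply, hh.mdot_apply, hh'.mdot_apply]; ring
  mdot_sub x y := by
    rw [Equiv.Perm.mul_apply, Equiv.Perm.mul_apply, hh.mdot_sub, hh'.mdot_sub,
      mdot_sub_right e (h' x), hh'.mdot_apply, hh'.mdot_apply, mdot_sub_right e x]
    ring

lemma one : ShearData 1 e r 0 0 where
  mdot_apply x := by simp
  mdot_sub x y := by simp

lemma pow (hh : ShearData h e r j s) (n : ℕ) : ShearData (h ^ n) e r (n * j) (n * s) := by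
  induction n with
  | zero => simpa using one
  | succ n ih =>
    rw [pow_succ]
    convert ih.mul hh using 1 <;> push_cast <;> ring

lemma addRight {v : V3} (hv : mdot e v = 0) : ShearData (Equiv.addRight v) e r 0 0 where
  mdot_apply x := by simp [mdot_add_right, hv]
  mdot_sub x y := by simp

end ShearData

lemma exists_int_abs_add_mul_le (t : ℝ) {p : ℝ} (hp : p ≠ 0) : ∃ a : ℤ, |t + a * p| ≤ |p| := by
  refine ⟨-⌊t / p⌋, ?_⟩
  have h : t + ((-⌊t / p⌋ : ℤ) : ℝ) * p = Int.fract (t / p) * p := by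
    rw [Int.fract, sub_mul, div_mul_cancel₀ t hp]; push_cast; ring
  rw [h, abs_mul, abs_of_nonneg (Int.fract_nonneg _)]
  exact mul_le_of_le_one_left (abs_nonneg p) (Int.fract_lt_one _).le

variable {e u1 u2 : V3} {γ1 γ2 : Equiv.Perm V3} {k : ℝ}

/-- Two parabolics with proportional null vectors `e` and `k • e`, `0 < k`. -/
lemma not_properlyDisc_of_parallel_of_pos {Γ : Subgroup (Equiv.Perm V3)}
    (hΓ1 : γ1 ∈ Γ) (hΓ2 : γ2 ∈ Γ) (he0 : e ≠ 0) (he : mdot e e = 0) (hk : 0 < k)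
    (hγ1 : ∀ x, γ1 x = x + lcross e x - (mdot e x / 2) • e + u1)
    (hγ2 : ∀ x, γ2 x = x + k • lcross e x - (k ^ 2 / 2 * mdot e x) • e + u2)
    (hs : mdot e u1 * mdot e u2 < 0) : ¬ properlyDisc Γ := by
  obtain ⟨s₁, hs₁⟩ : ∃ s, s = mdot e u1 := ⟨_, rfl⟩
  obtain ⟨s₂, hs₂⟩ : ∃ s, s = mdot e u2 := ⟨_, rfl⟩
  rw [← hs₁, ← hs₂] at hs
  obtain ⟨ρ, hρ⟩ : ∃ ρ, ρ = s₂ - k * s₁ := ⟨_, rfl⟩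
  have hs10 : s₁ ≠ 0 := left_ne_zero_of_mul hs.ne
  have hs20 : s₂ ≠ 0 := right_ne_zero_of_mul hs.ne
  have hρ0 : ρ ≠ 0 := by
    intro h0
    have : s₂ = k * s₁ := by linarith
    rw [this] at hs
    nlinarith [mul_nonneg hk.le (mul_self_nonneg s₁)]
  obtain ⟨r, hr⟩ : ∃ r, r = lcross e u2 - (s₂ / 2) • e - k • lcross e u1
    + (k ^ 2 / 2 * s₁) • e := ⟨_, rfl⟩
  have her : mdot e r = 0 := by
    rw [hr]
    simp only [mdot_add_right, mdot_sub_right, mdot_smul_right, mdot_lcross_self_left, he]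
    ring
  have hecr : lcross e r = (-ρ) • e := by
    rw [hr]
    simp only [lcross_add_right, lcross_sub_right, lcross_smul_right, lcross_self, lcross_lcross,
      he, hρ, ← hs₁, ← hs₂]
    module
  have hrr : mdot r r = ρ ^ 2 := by
    have h1 : mdot r (lcross e u2) = s₂ * ρ := by
      rw [mdot_lcross_cycle, lcross_anticomm r e, hecr, ← neg_smul, mdot_smul_left, ← hs₂]; ring
    have h2 : mdot r (lcross e u1) = s₁ * ρ := by
      rw [mdot_lcross_cycle, lcross_anticomm r e, hecr, ← neg_smul, mdot_smul_left, ← hs₁]; ring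
    nth_rewrite 2 [hr]
    simp only [mdot_add_right, mdot_sub_right, mdot_smul_right, h1, h2, mdot_comm r e, her]
    rw [hρ]; ring
  have hrc : ∀ x, mdot r (lcross e x) = ρ * mdot e x := fun x => by
    rw [mdot_lcross_cycle, lcross_anticomm r e, hecr, ← neg_smul, mdot_smul_left, neg_neg]
  have hR : Equiv.addRight r ∈ Γ := by
    have : Equiv.addRight r = γ1 * γ2 * (γ2 * γ1)⁻¹ := by
      rw [eq_mul_inv_iff_mul_eq]
      ext1 x
      simp only [Equiv.Perm.mul_apply, Equiv.coe_addRight, hγ1, hγ2, hr]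
      simp only [lcross_add_right, lcross_sub_right, lcross_smul_right, lcross_self, lcross_lcross,
        mdot_add_right, mdot_sub_right, mdot_smul_right, mdot_lcross_self_left, he, ← hs₁, ← hs₂]
      module
    rw [this]
    exact Γ.mul_mem (Γ.mul_mem hΓ1 hΓ2) (Γ.inv_mem (Γ.mul_mem hΓ2 hΓ1))
  have hE : Equiv.addRight (ρ • e) ∈ Γ := by
    have : Equiv.addRight (ρ • e) = Equiv.addRight r * (γ1 * Equiv.addRight r * γ1⁻¹)⁻¹ := by
      rw [eq_mul_inv_iff_mul_eq, ← mul_assoc, mul_inv_eq_iff_eq_mul]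
      ext1 x
      simp only [Equiv.Perm.mul_apply, Equiv.coe_addRight, hγ1]
      simp only [lcross_add_right, mdot_add_right, her, hecr]
      module
    rw [this]
    exact Γ.mul_mem hR (Γ.inv_mem (Γ.mul_mem (Γ.mul_mem hΓ1 hR) (Γ.inv_mem hΓ1)))
  have hd1 : ShearData γ1 e r ρ s₁ :=
    { mdot_apply := fun x => by
        simp only [hγ1, mdot_add_right, mdot_sub_right, mdot_smul_right, mdot_lcross_self_left, he,
          hs₁]
        ring
      mdot_sub := fun x y => by
        simp only [hγ1, mdot_add_right, mdot_sub_right, mdot_smul_right, hrc, mdot_comm r e, her]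
        ring }
  have hd2 : ShearData γ2 e r (k * ρ) s₂ :=
    { mdot_apply := fun x => by
        simp only [hγ2, mdot_add_right, mdot_sub_right, mdot_smul_right, mdot_lcross_self_left, he,
          hs₂]
        ring
      mdot_sub := fun x y => by
        simp only [hγ2, mdot_add_right, mdot_sub_right, mdot_smul_right, hrc, mdot_comm r e, her]
        ring }
  obtain ⟨f, hf⟩ : ∃ f, mdot e f ≠ 0 := by
    by_contra! h
    exact he0 (eq_of_forall_mdot fun x => by rw [h, mdot_zero_left])
  have hc : 0 < -s₁ / s₂ := by
    have h1 : -s₁ / s₂ = -(s₁ * s₂) / s₂ ^ 2 := by field_simp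
    rw [h1]
    exact div_pos (neg_pos.2 hs) (by positivity)
  have hstep : ∀ n : ℕ, ∃ h : Equiv.Perm V3, h ∈ Γ ∧
      ShearData h e r (n * ρ + ⌊n * (-s₁ / s₂)⌋₊ * (k * ρ)) (n * s₁ + ⌊n * (-s₁ / s₂)⌋₊ * s₂) ∧
      |mdot r (h 0)| ≤ ρ ^ 2 ∧ |mdot f (h 0)| ≤ |ρ * mdot f e| := by
    intro n
    obtain ⟨y, hy⟩ : ∃ y, y = (γ2 ^ ⌊n * (-s₁ / s₂)⌋₊ * γ1 ^ n) 0 := ⟨_, rfl⟩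
    obtain ⟨a, ha⟩ := exists_int_abs_add_mul_le (mdot r y) (pow_ne_zero 2 hρ0)
    obtain ⟨b, hb⟩ := exists_int_abs_add_mul_le (mdot f y + a * mdot f r)
      (mul_ne_zero hρ0 (mdot_comm e f ▸ hf))
    have hval : (Equiv.addRight (ρ • e) ^ b * (Equiv.addRight r ^ a *
        (γ2 ^ ⌊n * (-s₁ / s₂)⌋₊ * γ1 ^ n))) 0 = y + (a : ℝ) • r + (b * ρ : ℝ) • e := by
      rw [Equiv.Perm.mul_apply, Equiv.Perm.mul_apply, ← hy, Equiv.zsmul_addRight,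
        Equiv.zsmul_addRight, Equiv.coe_addRight, Equiv.coe_addRight]
      module
    refine ⟨Equiv.addRight (ρ • e) ^ b * (Equiv.addRight r ^ a *
      (γ2 ^ ⌊n * (-s₁ / s₂)⌋₊ * γ1 ^ n)), Γ.mul_mem (Γ.zpow_mem hE b)
      (Γ.mul_mem (Γ.zpow_mem hR a) (Γ.mul_mem (Γ.pow_mem hΓ2 _) (Γ.pow_mem hΓ1 _))), ?_, ?_, ?_⟩
    · rw [Equiv.zsmul_addRight, Equiv.zsmul_addRight]
      convert (ShearData.addRight (?_ : mdot e (b • ρ • e) = 0)).mul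
        ((ShearData.addRight (?_ : mdot e (a • r) = 0)).mul ((hd2.pow _).mul (hd1.pow n)))
        using 1
      · ring
      · ring
      · rw [← Int.cast_smul_eq_zsmul ℝ, mdot_smul_right, mdot_smul_right, he]; ring
      · rw [← Int.cast_smul_eq_zsmul ℝ, mdot_smul_right, her, mul_zero]
    · rw [hval, mdot_add_right, mdot_add_right, mdot_smul_right, mdot_smul_right, hrr,
        mdot_comm r e, her, mul_zero, add_zero]
      exact ha.trans_eq (abs_of_nonneg (sq_nonneg ρ))
    · rw [hval, mdot_add_right, mdot_add_right, mdot_smul_right, mdot_smul_right, mul_assoc]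
      exact hb
  choose h hΓ hd hhr hhf using hstep
  have hinj : Function.Injective h := by
    have hlt : StrictMono fun n : ℕ => (n : ℝ) + k * ⌊n * (-s₁ / s₂)⌋₊ := by
      intro i j hij
      have h4 : (⌊i * (-s₁ / s₂)⌋₊ : ℝ) ≤ ⌊j * (-s₁ / s₂)⌋₊ :=
        Nat.cast_le.2 (Nat.floor_mono (by gcongr))
      have h5 : (i : ℝ) < j := by exact_mod_cast hij
      exact add_lt_add_of_lt_of_le h5 (mul_le_mul_of_nonneg_left h4 hk.le)
    intro i j heq
    have h1 := (hd i).mdot_sub f 0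
    rw [heq, (hd j).mdot_sub f 0, sub_zero, add_right_inj] at h1
    have h2 := mul_right_cancel₀ hf h1
    exact hlt.injective (mul_right_cancel₀ hρ0 (by linear_combination -h2))
  have hdet : mdot e (lcross r f) ≠ 0 := by
    rw [mdot_lcross_cycle, hecr, mdot_smul_left]
    exact mul_ne_zero (neg_ne_zero.2 hρ0) hf
  obtain ⟨K, hK, hK'⟩ := exists_compact_of_bounded hdet (|s₂| + ρ ^ 2 + |ρ * mdot f e|)
  have hpos := sq_nonneg ρ
  have hpos' := abs_nonneg (ρ * mdot f e)
  have hpos'' := abs_nonneg s₂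
  have hK0 : (0 : V3) ∈ K := by
    refine hK' 0 ?_ ?_ ?_ <;> rw [mdot_zero_right, abs_zero] <;> positivity
  refine not_properlyDisc_of_injective hK hinj hΓ (x := fun _ => 0) (fun _ => hK0)
    fun n => hK' _ ?_ (by linarith [hhr n]) (by linarith [hhf n])
  have hn : 0 ≤ n * (-s₁ / s₂) := by positivity
  have h1 : mdot e (h n 0) = (⌊n * (-s₁ / s₂)⌋₊ - n * (-s₁ / s₂)) * s₂ := by
    rw [(hd n).mdot_apply, mdot_zero_right]; field_simp; ring
  have h2 : |(⌊n * (-s₁ / s₂)⌋₊ : ℝ) - n * (-s₁ / s₂)| ≤ 1 := by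
    rw [abs_le]
    constructor <;> linarith [Nat.floor_le hn, Nat.lt_floor_add_one (n * (-s₁ / s₂))]
  rw [h1, abs_mul]
  linarith [mul_le_mul_of_nonneg_right h2 hpos'']

/-- Two parabolics of opposite signs with proportional null vectors `e` and `k • e`. -/
lemma not_properlyDisc_of_parallel {Γ : Subgroup (Equiv.Perm V3)}
    (hΓ1 : γ1 ∈ Γ) (hΓ2 : γ2 ∈ Γ) (he0 : e ≠ 0) (he : mdot e e = 0)
    (hγ1 : ∀ x, γ1 x = x + lcross e x - (mdot e x / 2) • e + u1)
    (hγ2 : ∀ x, γ2 x = x + k • lcross e x - (k ^ 2 / 2 * mdot e x) • e + u2)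
    (hs : mdot e u1 * (k * mdot e u2) < 0) : ¬ properlyDisc Γ := by
  rcases lt_trichotomy k 0 with hk | rfl | hk
  · have he' : ∀ x, mdot e (γ2 x) = mdot e x + mdot e u2 := fun x => by
      simp only [hγ2, mdot_add_right, mdot_sub_right, mdot_smul_right, mdot_lcross_self_left, he]
      ring
    obtain ⟨z, hz⟩ := γ2.surjective 0
    have hu := he' z
    have h0 := hγ2 z
    rw [hz] at hu h0
    rw [mdot_zero_right] at hu
    refine not_properlyDisc_of_parallel_of_pos (γ2 := γ2⁻¹) (u2 := z) (k := -k) hΓ1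
      (Γ.inv_mem hΓ2) he0 he (neg_pos.2 hk) hγ1 (fun y => γ2.injective ?_) ?_
    · rw [perm_apply_inv, ← sub_eq_zero, ← sub_eq_zero.2 h0, hγ2]
      simp only [lcross_add_right, lcross_sub_right, lcross_smul_right, lcross_self, lcross_lcross,
        mdot_add_right, mdot_sub_right, mdot_smul_right, mdot_lcross_self_left, he]
      module
    · have h1 : mdot e z = -mdot e u2 := by linarith
      rw [h1]
      nlinarith
  · simp at hs
  · exact not_properlyDisc_of_parallel_of_pos hΓ1 hΓ2 he0 he hk hγ1 hγ2
      (by nlinarith)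

end ParallelParabolics

/-- Opposite sign lemma: if the affine isometries `γ₁`, `γ₂`, each
hyperbolic or parabolic, have strictly opposite signs (Margulis invariants with
respect to positive fixed vectors of their linear parts), then the group they
generate does not act properly discontinuously on ℝ³. -/
theorem opposite_sign_lemma
    (g1 g2 : Matrix (Fin 3) (Fin 3) ℝ) (u1 u2 v1 v2 : V3)
    (γ1 γ2 : Equiv.Perm V3)
    (hg1 : inSO21p g1) (hg2 : inSO21p g2)
    (ht1 : isHyperbolic g1 ∨ isParabolic g1)
    (ht2 : isHyperbolic g2 ∨ isParabolic g2)
    (hγ1 : ∀ x : V3, γ1 x = g1.mulVec x + u1)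
    (hγ2 : ∀ x : V3, γ2 x = g2.mulVec x + u2)
    (hv1 : positiveFixed g1 v1) (hv2 : positiveFixed g2 v2)
    (hsign : (0 < mdot u1 v1 ∧ mdot u2 v2 < 0) ∨
             (mdot u1 v1 < 0 ∧ 0 < mdot u2 v2)) :
    ¬ properlyDisc (Subgroup.closure {γ1, γ2}) := by
  obtain ⟨t1, ht10, hF1⟩ := hg1.skewVec_of_positiveFixed ht1 hv1
  obtain ⟨t2, ht20, hF2⟩ := hg2.skewVec_of_positiveFixed ht2 hv2
  have hs : mdot (skewVec g1) u1 * mdot (skewVec g2) u2 < 0 := by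
    have h : mdot u1 v1 * mdot u2 v2 < 0 := by
      rcases hsign with ⟨h1, h2⟩ | ⟨h1, h2⟩
      · exact mul_neg_of_pos_of_neg h1 h2
      · exact mul_neg_of_neg_of_pos h1 h2
    rw [hF1, hF2, mdot_smul_left, mdot_smul_left, mdot_comm v1, mdot_comm v2]
    nlinarith [mul_pos ht10 ht20]
  have hΓ1 : γ1 ∈ Subgroup.closure {γ1, γ2} := Subgroup.subset_closure (Set.mem_insert _ _)
  have hΓ2 : γ2 ∈ Subgroup.closure {γ1, γ2} :=
    Subgroup.subset_closure (Set.mem_insert_of_mem _ rfl)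
  have hscale : ∀ {e u : V3} {c : ℝ}, mdot ((2 : ℝ) • e) u * c < 0 → mdot e u * c < 0 :=
    fun h => by rw [mdot_smul_left] at h; linarith
  rcases ht1 with ht1 | ht1 <;> rcases ht2 with ht2 | ht2
  · exact not_properlyDisc_of_hyperbolic_of_hyperbolic hΓ1 hΓ2 hg1 hg2 hγ1 hγ2
      (hg1.three_lt_trace ht1) (hg2.three_lt_trace ht2) hs
  · obtain ⟨e, he, hF⟩ := hg2.exists_isParabolicWith ht2
    rw [hF, mul_comm] at hs
    exact not_properlyDisc_of_parabolic_of_hyperbolic hΓ2 hΓ1 hg2 hg1 hγ2 hγ1 he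
      (hg1.three_lt_trace ht1) (hscale hs)
  · obtain ⟨e, he, hF⟩ := hg1.exists_isParabolicWith ht1
    rw [hF] at hs
    exact not_properlyDisc_of_parabolic_of_hyperbolic hΓ1 hΓ2 hg1 hg2 hγ1 hγ2 he
      (hg2.three_lt_trace ht2) (hscale hs)
  · obtain ⟨e, he, hF⟩ := hg1.exists_isParabolicWith ht1
    obtain ⟨e', he', hF'⟩ := hg2.exists_isParabolicWith ht2
    rw [hF, hF', mul_comm] at hs
    replace hs := hscale hs
    rw [mul_comm] at hs
    replace hs := hscale hs
    by_cases hee : mdot e e' = 0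
    · obtain ⟨k, rfl⟩ := null_parallel he'.null he.null (by rw [mdot_comm, hee]) he.ne_zero
      refine not_properlyDisc_of_parallel hΓ1 hΓ2 he.ne_zero he.null
        (fun x => by rw [hγ1, he.mulVec_eq]) (k := k) (fun x => ?_)
        (by rwa [mdot_smul_left] at hs)
      rw [hγ2, he'.mulVec_eq, lcross_smul_left, mdot_smul_left]
      module
    · exact not_properlyDisc_of_parabolic_of_parabolic hΓ1 hΓ2 hg1 hg2 hγ1 hγ2 he he' hee hs
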